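/- Let n ≥ 2, 1 ≤ k ≤ n−1 and ℓ ≥ 1 be integers, and set d = n / gcd(n, ℓ). Then there exists a ρ^ℓ-symmetric weakly separated collection D ⊆ C([n], k) of cardinality k(n−k)+1 if and only if k is congruent to −1, 0, or 1 modulo d. -/

import Mathlib

open Finset

/-- `x +_n t`: add `t` to `x ∈ [n] = {1,…,n}` modulo `n`, with representative in `[n]`. -/
def shiftMod (n t x : ℕ) : ℕ := (x + t - 1) % n + 1

/-- `S +_n t`: add `t` to every element of `S ⊆ [n]` modulo `n`. -/
def shiftSet (n t : ℕ) (S : Finset ℕ) : Finset ℕ := S.image (shiftMod n t)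

/-- `x +_n t` for an integer shift `t`. -/
def shiftModZ (n : ℕ) (t : ℤ) (x : ℕ) : ℕ := ((((x : ℤ) + t - 1) % (n : ℤ)) + 1).toNat

/-- `S +_n t` for an integer shift `t`. -/
def shiftSetZ (n : ℕ) (t : ℤ) (S : Finset ℕ) : Finset ℕ := S.image (shiftModZ n t)

/-- Two sets `S`, `T` are weakly separated if there are no `a < b < c < d` with
`a, c ∈ S \ T` and `b, d ∈ T \ S`, nor with the roles of `S` and `T` exchanged. -/
def WeaklySeparated (S T : Finset ℕ) : Prop :=
  ¬ ∃ a b c d : ℕ, a < b ∧ b < c ∧ c < d ∧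
    ((a ∈ S \ T ∧ c ∈ S \ T ∧ b ∈ T \ S ∧ d ∈ T \ S) ∨
     (a ∈ T \ S ∧ c ∈ T \ S ∧ b ∈ S \ T ∧ d ∈ S \ T))

/-- The cyclic successor of `x` in a finite set `P ⊆ ℕ`: the least element of `P`
greater than `x` if one exists, and otherwise the least element of `P`. -/
def cyclicSucc (P : Finset ℕ) (x : ℕ) : ℕ :=
  if h : (P.filter (fun y => x < y)).Nonempty then (P.filter (fun y => x < y)).min' h
  else if h2 : P.Nonempty then P.min' h2 else 0

open scoped Classical in
/-- The cyclic interval of `P` from `u` to `v`: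
`{u, S_P(u), …, S_P^m(u)}` where `m ≥ 0` is minimal with `S_P^m(u) = v`. -/
noncomputable def cyclicIntervalTo (P : Finset ℕ) (u v : ℕ) : Finset ℕ :=
  if h : ∃ m : ℕ, (cyclicSucc P)^[m] u = v then
    (Finset.range (Nat.find h + 1)).image (fun j => (cyclicSucc P)^[j] u)
  else ∅

/-- The orbit `ā = {a + iℓ : 0 ≤ i ≤ d−1} ⊆ [dℓ]` of `a ∈ [ℓ]`. -/
def orbit (d ℓ a : ℕ) : Finset ℕ := (Finset.range d).image (fun i => a + i * ℓ)

/-- `P_s = [n] \ (ā_{a_1} ∪ … ∪ ā_{a_{s−1}})`, where `n = dℓ`. -/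
def Pset (d ℓ : ℕ) (a : ℕ → ℕ) (s : ℕ) : Finset ℕ :=
  Finset.Icc 1 (d * ℓ) \ (Finset.Icc 1 (s - 1)).biUnion (fun i => orbit d ℓ (a i))

/-- `P_{s,h} = P_s \ {a_s +_n hℓ, …, a_s +_n (d−1)ℓ}` for `1 ≤ h ≤ d−1`; `P_{s,d} = P_s`. -/
def Psh (d ℓ : ℕ) (a : ℕ → ℕ) (s h : ℕ) : Finset ℕ :=
  Pset d ℓ a s \ (Finset.Ico h d).image (fun j => shiftMod (d * ℓ) (j * ℓ) (a s))

/-- `I(i,h) = {i, S_{P_{s,h}}(i), S_{P_{s,h}}²(i), …, S_{P_{s,h}}^{k−1}(i)}`. -/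
def Iih (d ℓ k : ℕ) (a : ℕ → ℕ) (s h i : ℕ) : Finset ℕ :=
  (Finset.range k).image (fun j => (cyclicSucc (Psh d ℓ a s h))^[j] i)

/-- `B_s = {I(i,h) : i` in the cyclic interval of `P_s` from `S_{P_s}(a_s +_n (n−ℓ))` to
`a_s`, `1 ≤ h ≤ d`, `|I(i,h)| = k}`. -/
noncomputable def Bset (d ℓ k : ℕ) (a : ℕ → ℕ) (s : ℕ) : Finset (Finset ℕ) :=
  (((cyclicIntervalTo (Pset d ℓ a s)
        (cyclicSucc (Pset d ℓ a s) (shiftMod (d * ℓ) (d * ℓ - ℓ) (a s)))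
        (a s)) ×ˢ (Finset.Icc 1 d)).image
      (fun p => Iih d ℓ k a s p.2 p.1)).filter (fun I => I.card = k)

/-- `L_s = {I +_n xℓ : I ∈ B_s, 1 ≤ x ≤ d}`. -/
noncomputable def Lset (d ℓ k : ℕ) (a : ℕ → ℕ) (s : ℕ) : Finset (Finset ℕ) :=
  ((Bset d ℓ k a s) ×ˢ (Finset.Icc 1 d)).image (fun p => shiftSet (d * ℓ) (p.2 * ℓ) p.1)

/-- The output collection `D = L_1 ∪ … ∪ L_{ℓ−r+1}`. -/
noncomputable def Dcol (d ℓ k r : ℕ) (a : ℕ → ℕ) : Finset (Finset ℕ) :=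
  (Finset.Icc 1 (ℓ - r + 1)).biUnion (fun s => Lset d ℓ k a s)

/-- The map `F : [n] → [dℓ]`, `F(a + gx) = a + ℓx` for `1 ≤ a ≤ g`, `0 ≤ x ≤ d−1`. -/
def Fmap (g ℓ y : ℕ) : ℕ := (y - 1) % g + 1 + ℓ * ((y - 1) / g)

/-- Every element of `I \ J` lies below all of `J \ I` or above all of `J \ I`. -/
def Surrounds (I J : Finset ℕ) : Prop :=
  ∀ i j j', i ∈ I → i ∉ J → j ∈ J → j ∉ I → j' ∈ J → j' ∉ I → j < i → i < j' → False

/-- Weak separation in the sense of Leclerc and Zelevinsky, for sets of arbitrary sizes. -/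
def LZSep (I J : Finset ℕ) : Prop :=
  (#I ≤ #J ∧ Surrounds I J) ∨ (#J ≤ #I ∧ Surrounds J I)

/-- A family of pairwise Leclerc–Zelevinsky separated subsets of `{0, …, n - 1}`. -/
structure LZFam (n : ℕ) (C : Finset (Finset ℕ)) : Prop where
  sub : ∀ I ∈ C, I ⊆ range n
  sep : ∀ I ∈ C, ∀ J ∈ C, LZSep I J

lemma LZSep.symm {I J : Finset ℕ} (h : LZSep I J) : LZSep J I := Or.symm h

lemma LZSep.surrounds {I J : Finset ℕ} (h : LZSep I J) (hc : #I < #J) : Surrounds I J := by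
  rcases h with h | h
  · exact h.2
  · omega

lemma LZSep.refl (I : Finset ℕ) : LZSep I I :=
  Or.inl ⟨le_rfl, fun _ _ _ h1 h2 => absurd h1 h2⟩

lemma LZSep.erase {n : ℕ} {I J : Finset ℕ} (hI : I ⊆ range (n + 1)) (hJ : J ⊆ range (n + 1))
    (h : LZSep I J) : LZSep (I.erase n) (J.erase n) := by
  have key : ∀ I J : Finset ℕ, I ⊆ range (n + 1) → J ⊆ range (n + 1) → #I ≤ #J →
      Surrounds I J → LZSep (I.erase n) (J.erase n) := by
    intro I J hI hJ hc hs
    have mono : Surrounds (I.erase n) (J.erase n) := by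
      intro i j j' h1 h2 h3 h4 h5 h6 h7 h8
      simp only [mem_erase, ne_eq, not_and] at *
      exact hs i j j' h1.2 (h2 h1.1) h3.2 (h4 h3.1) h5.2 (h6 h5.1) h7 h8
    by_cases nJ : n ∈ J
    · by_cases nI : n ∈ I
      · exact Or.inl ⟨by rw [card_erase_of_mem nI, card_erase_of_mem nJ]; omega, mono⟩
      · by_cases hlt : #I < #J
        · exact Or.inl ⟨by rw [erase_eq_of_notMem nI, card_erase_of_mem nJ]; omega, mono⟩
        · refine Or.inr ⟨by rw [erase_eq_of_notMem nI, card_erase_of_mem nJ]; omega, ?_⟩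
          intro j i i' h1 h2 h3 h4 h5 h6 h7 h8
          simp only [mem_erase, ne_eq, not_and] at *
          have hi' := hI h5.2
          have := hJ h1.2
          simp only [mem_range] at this
          exact hs i' j n h5.2 (h6 h5.1) h1.2 (h2 h1.1) nJ nI h8 (by
            simp only [mem_range] at hi'; omega)
    · refine Or.inl ⟨?_, mono⟩
      rw [erase_eq_of_notMem nJ]
      exact (card_le_card (erase_subset _ _)).trans hc
  rcases h with ⟨h1, h2⟩ | ⟨h1, h2⟩
  · exact key I J hI hJ h1 h2
  · exact (key J I hJ hI h1 h2).symm

/-- The family obtained from `C` by deleting the element `n` from every member. -/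
def delFam (n : ℕ) (C : Finset (Finset ℕ)) : Finset (Finset ℕ) := C.image (fun I => I.erase n)

lemma LZFam.del {n : ℕ} {C : Finset (Finset ℕ)} (hC : LZFam (n + 1) C) :
    LZFam n (delFam n C) := by
  constructor
  · intro I hI x hx
    obtain ⟨J, hJ, rfl⟩ := mem_image.1 hI
    have := hC.sub J hJ (mem_of_mem_erase hx)
    have := ne_of_mem_erase hx
    simp only [mem_range] at *
    omega
  · intro I hI J hJ
    obtain ⟨I', hI', rfl⟩ := mem_image.1 hI
    obtain ⟨J', hJ', rfl⟩ := mem_image.1 hJ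
    exact (hC.sep I' hI' J' hJ').erase (hC.sub I' hI') (hC.sub J' hJ')

lemma mem_delFam {n : ℕ} {C : Finset (Finset ℕ)} {I : Finset ℕ} (hn : n ∉ I) :
    I ∈ delFam n C ↔ I ∈ C ∨ insert n I ∈ C := by
  constructor
  · intro h
    obtain ⟨J, hJ, rfl⟩ := mem_image.1 h
    by_cases hnJ : n ∈ J
    · exact Or.inr (by rwa [insert_erase hnJ])
    · exact Or.inl (by rwa [erase_eq_of_notMem hnJ])
  · rintro (h | h)
    · exact mem_image.2 ⟨I, h, erase_eq_of_notMem hn⟩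
    · exact mem_image.2 ⟨_, h, erase_insert hn⟩

/-- The members `X ∌ n` of `C` such that `X ∪ {n}` is also in `C`. -/
def dblFam (n : ℕ) (C : Finset (Finset ℕ)) : Finset (Finset ℕ) :=
  C.filter (fun X => n ∉ X ∧ insert n X ∈ C)

lemma card_eq_del_add_dbl (n : ℕ) (C : Finset (Finset ℕ)) :
    #C = #(delFam n C) + #(dblFam n C) := by
  classical
  have h1 : #C = #(C.filter (fun X => n ∉ X)) + #(C.filter (fun X => n ∈ X)) := by
    rw [add_comm, card_filter_add_card_filter_not]
  have h2 : #((C.filter (fun X => n ∈ X)).image (fun I => I.erase n)) =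
      #(C.filter (fun X => n ∈ X)) := by
    apply card_image_of_injOn
    intro X hX Y hY h
    simp only [coe_filter, Set.mem_ofPred_eq] at hX hY
    rw [← insert_erase hX.2, ← insert_erase hY.2]
    exact congrArg _ h
  have h3 : delFam n C = C.filter (fun X => n ∉ X) ∪
      (C.filter (fun X => n ∈ X)).image (fun I => I.erase n) := by
    ext I
    by_cases hn : n ∈ I
    · constructor
      · intro h
        obtain ⟨J, -, rfl⟩ := mem_image.1 h
        simp at hn
      · intro h
        rcases mem_union.1 h with h | h
        · exact absurd hn (mem_filter.1 h).2
        · obtain ⟨J, -, rfl⟩ := mem_image.1 h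
          simp at hn
    · rw [mem_delFam hn]
      simp only [mem_union, mem_filter, mem_image]
      constructor
      · rintro (h | h)
        · exact Or.inl ⟨h, hn⟩
        · exact Or.inr ⟨_, ⟨h, mem_insert_self _ _⟩, erase_insert hn⟩
      · rintro (h | ⟨J, ⟨hJ, hnJ⟩, rfl⟩)
        · exact Or.inl h.1
        · exact Or.inr (by rwa [insert_erase hnJ])
  have h4 : dblFam n C = C.filter (fun X => n ∉ X) ∩
      (C.filter (fun X => n ∈ X)).image (fun I => I.erase n) := by
    ext I
    simp only [dblFam, mem_inter, mem_filter, mem_image]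
    constructor
    · rintro ⟨h, hn, h'⟩
      exact ⟨⟨h, hn⟩, _, ⟨h', mem_insert_self _ _⟩, erase_insert hn⟩
    · rintro ⟨⟨h, hn⟩, J, ⟨hJ, hnJ⟩, rfl⟩
      exact ⟨h, hn, by rwa [insert_erase hnJ]⟩
  rw [h3, h4, card_union_add_card_inter, h1, h2]

lemma LZFam.lt_of_insert {n : ℕ} {C : Finset (Finset ℕ)} (hC : LZFam (n + 1) C)
    {X Y : Finset ℕ} (hX : X ∈ C) (nX : n ∉ X) (hY : insert n Y ∈ C) (nY : n ∉ Y)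
    (hc : #X ≤ #Y) {x y : ℕ} (hx : x ∈ X) (hxY : x ∉ Y) (hy : y ∈ Y) (hyX : y ∉ X) : x < y := by
  by_contra hlt
  have hne : x ≠ y := fun h => hxY (h ▸ hy)
  have hs := (hC.sep X hX _ hY).surrounds (by rw [card_insert_of_notMem nY]; omega)
  have hxn : x ≠ n := fun h => nX (h ▸ hx)
  have := mem_range.1 (hC.sub X hX hx)
  exact hs x y n hx (by simp [hxn, hxY]) (mem_insert_of_mem hy) hyX (mem_insert_self _ _) nX
    (by omega) (by omega)

lemma mem_dblFam {n : ℕ} {C : Finset (Finset ℕ)} {X : Finset ℕ} :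
    X ∈ dblFam n C ↔ X ∈ C ∧ n ∉ X ∧ insert n X ∈ C := mem_filter

lemma LZFam.card_injOn_dbl {n : ℕ} {C : Finset (Finset ℕ)} (hC : LZFam (n + 1) C) :
    Set.InjOn card (dblFam n C : Set (Finset ℕ)) := by
  intro X hX Y hY h
  obtain ⟨hX, nX, hnX⟩ := mem_dblFam.1 hX
  obtain ⟨hY, nY, hnY⟩ := mem_dblFam.1 hY
  by_contra hne
  obtain ⟨x, hx, hxY⟩ := not_subset.1 (fun hs => hne (eq_of_subset_of_card_le hs h.ge))
  obtain ⟨y, hy, hyX⟩ := not_subset.1 (fun hs => hne (eq_of_subset_of_card_le hs h.le).symm)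
  have h1 := hC.lt_of_insert hX nX hnY nY h.le hx hxY hy hyX
  have h2 := hC.lt_of_insert hY nY hnX nX h.ge hy hyX hx hxY
  omega

lemma LZFam.image_card_dbl_subset {n : ℕ} {C : Finset (Finset ℕ)} (hC : LZFam (n + 1) C) :
    (dblFam n C).image card ⊆ range (n + 1) := by
  intro j hj
  obtain ⟨X, hX, rfl⟩ := mem_image.1 hj
  obtain ⟨hX, nX, -⟩ := mem_dblFam.1 hX
  have : X ⊆ range n := by
    intro x hx
    have := mem_range.1 (hC.sub X hX hx)
    have hxn : x ≠ n := fun h => nX (h ▸ hx)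
    exact mem_range.2 (by omega)
  have := card_le_card this
  rw [card_range] at this
  exact mem_range.2 (by omega)

lemma LZFam.card_dbl_le {n : ℕ} {C : Finset (Finset ℕ)} (hC : LZFam (n + 1) C) :
    #(dblFam n C) ≤ n + 1 := by
  rw [← card_image_of_injOn hC.card_injOn_dbl, ← card_range (n + 1)]
  exact card_le_card hC.image_card_dbl_subset

/-- Leclerc–Zelevinsky bound. -/
theorem LZFam.two_mul_card_le {n : ℕ} : ∀ {C : Finset (Finset ℕ)}, LZFam n C →
    2 * #C ≤ n * (n + 1) + 2 := by
  induction n with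
  | zero =>
    intro C hC
    have : C ⊆ {∅} := fun I hI => by
      have := hC.sub I hI
      simpa using this
    have := card_le_card this
    simp at this
    omega
  | succ n ih =>
    intro C hC
    have h1 := ih hC.del
    have h2 := hC.card_dbl_le
    have h3 := card_eq_del_add_dbl n C
    nlinarith

/-- A separated family of the largest possible size. -/
structure MaxLZ (n : ℕ) (C : Finset (Finset ℕ)) : Prop extends LZFam n C where
  card_eq : 2 * #C = n * (n + 1) + 2

lemma MaxLZ.del {n : ℕ} {C : Finset (Finset ℕ)} (hC : MaxLZ (n + 1) C) :
    MaxLZ n (delFam n C) := by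
  refine ⟨hC.toLZFam.del, ?_⟩
  have h1 := hC.toLZFam.del.two_mul_card_le
  have h2 := hC.card_dbl_le
  have h3 := card_eq_del_add_dbl n C
  have h4 := hC.card_eq
  nlinarith

lemma MaxLZ.exists_dbl {n : ℕ} {C : Finset (Finset ℕ)} (hC : MaxLZ (n + 1) C) {j : ℕ}
    (hj : j ≤ n) : ∃ X ∈ C, n ∉ X ∧ insert n X ∈ C ∧ #X = j := by
  have h1 := hC.toLZFam.del.two_mul_card_le
  have h3 := card_eq_del_add_dbl n C
  have h4 := hC.card_eq
  have h5 : (dblFam n C).image card = range (n + 1) := by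
    apply eq_of_subset_of_card_le hC.image_card_dbl_subset
    rw [card_image_of_injOn hC.card_injOn_dbl, card_range]
    nlinarith
  have : j ∈ (dblFam n C).image card := by rw [h5]; exact mem_range.2 (by omega)
  obtain ⟨X, hX, rfl⟩ := mem_image.1 this
  obtain ⟨a, b, c⟩ := mem_dblFam.1 hX
  exact ⟨X, a, b, c, rfl⟩

lemma MaxLZ.mem_of_sep {n : ℕ} {C : Finset (Finset ℕ)} (hC : MaxLZ n C) {J : Finset ℕ}
    (hJ : J ⊆ range n) (h : ∀ I ∈ C, LZSep I J) : J ∈ C := by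
  by_contra hJC
  have : LZFam n (insert J C) := by
    constructor
    · intro I hI
      rcases mem_insert.1 hI with rfl | hI
      · exact hJ
      · exact hC.sub I hI
    · intro I hI K hK
      rcases mem_insert.1 hI with rfl | hI' <;> rcases mem_insert.1 hK with rfl | hK'
      · exact LZSep.refl _
      · exact (h K hK').symm
      · exact h I hI'
      · exact hC.sep I hI' K hK'
  have h1 := this.two_mul_card_le
  rw [card_insert_of_notMem hJC] at h1
  have := hC.card_eq
  omega

lemma MaxLZ.Ioo_mem {n : ℕ} {C : Finset (Finset ℕ)} (hC : MaxLZ n C) (b : ℕ) :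
    Ioo b n ∈ C := by
  apply hC.mem_of_sep
  · intro x hx
    simp only [mem_Ioo, mem_range] at *
    omega
  · intro I hI
    have hI := hC.sub I hI
    rcases le_total (#I) (#(Ioo b n)) with h | h
    · refine Or.inl ⟨h, fun i j j' h1 h2 h3 h4 h5 h6 h7 h8 => ?_⟩
      have := hI h1
      simp only [mem_Ioo, mem_range] at *
      omega
    · refine Or.inr ⟨h, fun i j j' h1 h2 h3 h4 h5 h6 h7 h8 => ?_⟩
      have := hI h5
      simp only [mem_Ioo, mem_range] at *
      omega

/-- In `C`, every edge from `X` to `X ∪ {b}` is either the special edge at `Ioo b n`, or has a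
next edge `X ∪ {b'}` above it with `b' > b`, or an edge `X ∪ {b} \ {c}` with `c < b`. -/
def HasNext (n : ℕ) (C : Finset (Finset ℕ)) : Prop :=
  ∀ X b, b ∉ X → X ∈ C → insert b X ∈ C → X = Ioo b n ∨
    (∃ b', b' ∉ X ∧ b < b' ∧ insert b' X ∈ C) ∨ (∃ c ∈ X, c < b ∧ (insert b X).erase c ∈ C)

lemma exists_erase_of_subset {W Q : Finset ℕ} (h : W ⊆ Q) (hc : #W + 1 = #Q) :
    ∃ y ∈ Q, y ∉ W ∧ W = Q.erase y := by
  obtain ⟨y, hy, rfl⟩ := exists_eq_insert_iff.2 ⟨h, hc⟩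
  exact ⟨y, mem_insert_self _ _, hy, (erase_insert hy).symm⟩

lemma mem_mem_of_sdiff_subset_pair {A B : Finset ℕ} {p q : ℕ}
    (h : ∀ x ∈ A, x ∉ B → x = p ∨ x = q) (hc : 2 ≤ #(A \ B)) :
    (p ∈ A ∧ p ∉ B) ∧ (q ∈ A ∧ q ∉ B) ∧ p ≠ q := by
  have hs : A \ B ⊆ {p, q} := by
    intro x hx
    rw [mem_sdiff] at hx
    simpa using h x hx.1 hx.2
  have hpq : p ≠ q := by
    rintro rfl
    have := card_le_card hs
    simp at this
    omega
  have he : A \ B = {p, q} := eq_of_subset_of_card_le hs (by rw [card_pair hpq]; exact hc)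
  have hp : p ∈ A \ B := by simp [he]
  have hq : q ∈ A \ B := by simp [he]
  exact ⟨mem_sdiff.1 hp, mem_sdiff.1 hq, hpq⟩

lemma two_le_card_sdiff {A B : Finset ℕ} (hc : #B + 1 = #A) (h : ¬ B ⊆ A) : 2 ≤ #(A \ B) := by
  have h1 := card_sdiff_add_card_inter A B
  have h2 := card_sdiff_add_card_inter B A
  rw [inter_comm] at h2
  have h3 : 0 < #(B \ A) := by
    rw [card_pos, sdiff_nonempty]
    exact h
  omega

lemma MaxLZ.next_of_notMem {n : ℕ} {C : Finset (Finset ℕ)} (hC : MaxLZ (n + 1) C)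
    (ih : HasNext n (delFam n C)) {X : Finset ℕ} {b : ℕ} (bn : b < n) (bX : b ∉ X) (nX : n ∉ X)
    (hX : X ∈ C) (hXb : insert b X ∈ C) : X = Ioo b (n + 1) ∨
    (∃ b', b' ∉ X ∧ b < b' ∧ insert b' X ∈ C) ∨
    (∃ c ∈ X, c < b ∧ (insert b X).erase c ∈ C) := by
  have nXb : n ∉ insert b X := by simp [nX]; omega
  have cXb : #(insert b X) = #X + 1 := card_insert_of_notMem bX
  have hsub : ∀ Y ∈ C, n ∉ Y → Y ⊆ range n := by
    intro Y hY nY y hy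
    have h1 := mem_range.1 (hC.sub Y hY hy)
    have h2 : y ≠ n := fun h => nY (h ▸ hy)
    exact mem_range.2 (by omega)
  have cn : #X + 1 ≤ n := by
    have := card_le_card (hsub _ hXb nXb)
    rwa [cXb, card_range] at this
  obtain ⟨W, hW, nW, hnW, cW⟩ := hC.exists_dbl (j := #X) (by omega)
  obtain ⟨Z, hZ, nZ, hnZ, cZ⟩ := hC.exists_dbl (j := #X + 1) (by omega)
  by_cases hWX : W = X
  · subst hWX
    exact Or.inr (Or.inl ⟨n, nX, bn, hnW⟩)
  have g1 : ∀ {x w}, x ∈ X → x ∉ W → w ∈ W → w ∉ X → x < w := fun h1 h2 h3 h4 =>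
    hC.lt_of_insert hX nX hnW nW cW.ge h1 h2 h3 h4
  have hWerase : W ⊆ insert b X → ∃ c ∈ X, c < b ∧ (insert b X).erase c ∈ C := by
    intro hs
    obtain ⟨y, hy, hyW, rfl⟩ := exists_erase_of_subset hs (by omega)
    have hyb : y ≠ b := by
      rintro rfl
      exact hWX (erase_insert bX)
    have hyX : y ∈ X := mem_of_mem_insert_of_ne hy hyb
    refine ⟨y, hyX, g1 hyX hyW (mem_erase.2 ⟨hyb.symm, mem_insert_self _ _⟩) bX, hW⟩
  rcases ih X b bX ((mem_delFam nX).2 (Or.inl hX)) ((mem_delFam nXb).2 (Or.inl hXb)) with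
    h | ⟨b', hb'X, hbb', hb'⟩ | ⟨c, hcX, hcb, hc⟩
  · refine Or.inr (Or.inl ⟨n, nX, bn, ?_⟩)
    have : insert n X = Ioo b (n + 1) := by
      ext x
      simp only [h, mem_insert, mem_Ioo]
      omega
    rw [this]
    exact hC.Ioo_mem b
  · have nXb' : n ∉ insert b' X := by
      intro h
      have := hC.toLZFam.del.sub _ hb' h
      simp at this
    rcases (mem_delFam nXb').1 hb' with h | h
    · exact Or.inr (Or.inl ⟨b', hb'X, hbb', h⟩)
    have cXb' : #(insert b' X) = #X + 1 := card_insert_of_notMem hb'X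
    have f1 : ∀ {x z}, x ∈ insert b X → x ∉ Z → z ∈ Z → z ∉ insert b X → x < z :=
      fun h1 h2 h3 h4 => hC.lt_of_insert hXb nXb hnZ nZ (by omega) h1 h2 h3 h4
    have f2 : ∀ {z y}, z ∈ Z → z ∉ insert b' X → y ∈ insert b' X → y ∉ Z → z < y :=
      fun h1 h2 h3 h4 => hC.lt_of_insert hZ nZ h nXb' (by omega) h1 h2 h3 h4
    by_cases hs : X ⊆ Z
    · obtain ⟨z, hz, rfl⟩ := exists_eq_insert_iff.2 ⟨hs, cZ.symm⟩
      by_cases hzb : z = b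
      · subst hzb
        have g2 : ∀ {w z'}, w ∈ W → w ∉ insert z X → z' ∈ insert z X → z' ∉ W → w < z' :=
          fun h1 h2 h3 h4 => hC.lt_of_insert hW nW hnZ nZ (by omega) h1 h2 h3 h4
        obtain ⟨x, hx, hxW⟩ := not_subset.1
          (fun hs => hWX (eq_of_subset_of_card_le hs cW.le).symm)
        refine Or.inr (Or.inr (hWerase fun w hw => ?_))
        by_contra hwQ
        have h1 := g1 hx hxW hw (fun h => hwQ (mem_insert_of_mem h))
        have h2 := g2 hw hwQ (mem_insert_of_mem hx) hxW
        omega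
      · refine Or.inr (Or.inl ⟨z, hz, ?_, hZ⟩)
        apply f1 (mem_insert_self _ _) _ (mem_insert_self _ _) <;> simp [bX, hz, hzb, Ne.symm hzb]
    · exfalso
      obtain ⟨x, hx, hxZ⟩ := not_subset.1 hs
      have hpair : ∀ z ∈ Z, z ∉ X → z = b ∨ z = b' := by
        intro z hz hzX
        by_contra hcon
        push Not at hcon
        have h1 := f1 (mem_insert_of_mem hx) hxZ hz (by simp [hzX, hcon.1])
        have h2 := f2 hz (by simp [hzX, hcon.2]) (mem_insert_of_mem hx) hxZ
        omega
      obtain ⟨⟨p1, p2⟩, ⟨p3, p4⟩, -⟩ :=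
        mem_mem_of_sdiff_subset_pair hpair (two_le_card_sdiff cZ.symm hs)
      have h1 := f1 (mem_insert_of_mem hx) hxZ p3 (by simp [p4]; omega)
      have h2 := f2 p1 (by simp [p2]; omega) (mem_insert_of_mem hx) hxZ
      exact (hC.sep X hX Z hZ).surrounds (by omega) x b b' hx hxZ p1 p2 p3 p4 h2 h1
  · have nV : n ∉ (insert b X).erase c := fun h => nXb (mem_of_mem_erase h)
    rcases (mem_delFam nV).1 hc with h | h
    · exact Or.inr (Or.inr ⟨c, hcX, hcb, h⟩)
    by_cases hs : W ⊆ insert b X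
    · exact Or.inr (Or.inr (hWerase hs))
    exfalso
    obtain ⟨w, hw, hwQ⟩ := not_subset.1 hs
    have hwX : w ∉ X := fun h => hwQ (mem_insert_of_mem h)
    have cV : #((insert b X).erase c) = #X := by
      rw [card_erase_of_mem (mem_insert_of_mem hcX)]
      omega
    have g2 : ∀ {q}, q ∈ (insert b X).erase c → q ∉ W → w < q :=
      fun h3 h4 => hC.lt_of_insert hW nW h nV (by omega) hw
        (fun h => hwQ (mem_of_mem_erase h)) h3 h4
    have hpair : ∀ q ∈ insert b X, q ∉ W → q = c ∨ q = b := by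
      intro q hq hqW
      by_contra hcon
      push Not at hcon
      have h1 := g1 (mem_of_mem_insert_of_ne hq hcon.2) hqW hw hwX
      have h2 := g2 (mem_erase.2 ⟨hcon.1, hq⟩) hqW
      omega
    obtain ⟨⟨p1, p2⟩, ⟨p3, p4⟩, hcb'⟩ :=
      mem_mem_of_sdiff_subset_pair hpair (two_le_card_sdiff (by omega) hs)
    have h1 := g1 hcX p2 hw hwX
    have h2 := g2 (mem_erase.2 ⟨hcb'.symm, p3⟩) p4
    exact (hC.sep W hW _ hXb).surrounds (by omega) w c b hw hwQ p1 p2 p3 p4 h1 h2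

lemma MaxLZ.next_of_mem {n : ℕ} {C : Finset (Finset ℕ)} (hC : MaxLZ (n + 1) C)
    (ih : HasNext n (delFam n C)) {X : Finset ℕ} {b : ℕ} (bn : b < n) (bX : b ∉ X) (nX : n ∈ X)
    (hX : X ∈ C) (hXb : insert b X ∈ C) : X = Ioo b (n + 1) ∨
    (∃ b', b' ∉ X ∧ b < b' ∧ insert b' X ∈ C) ∨
    (∃ c ∈ X, c < b ∧ (insert b X).erase c ∈ C) := by
  obtain ⟨Y, nY, rfl⟩ : ∃ Y, n ∉ Y ∧ X = insert n Y :=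
    ⟨X.erase n, by simp, (insert_erase nX).symm⟩
  have bY : b ∉ Y := fun h => bX (mem_insert_of_mem h)
  have nYb : n ∉ insert b Y := by simp [nY]; omega
  rw [insert_comm] at hXb
  have cYb : #(insert b Y) = #Y + 1 := card_insert_of_notMem bY
  have cYbn : #(insert n (insert b Y)) = #Y + 2 := by rw [card_insert_of_notMem nYb, cYb]
  rcases ih Y b bY ((mem_delFam nY).2 (Or.inr hX)) ((mem_delFam nYb).2 (Or.inr hXb)) with
    h | ⟨b', hb'Y, hbb', hb'⟩ | ⟨c, hcY, hcb, hc⟩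
  · left
    ext x
    simp only [h, mem_insert, mem_Ioo]
    omega
  · have hb'n : b' < n := by
      simpa using hC.toLZFam.del.sub _ hb' (mem_insert_self _ _)
    have nYb' : n ∉ insert b' Y := by simp [nY]; omega
    rcases (mem_delFam nYb').1 hb' with h | h
    · exfalso
      refine (hC.sep _ h _ hXb).surrounds ?_ b' b n (mem_insert_self _ _) ?_
        (by simp) ?_ (by simp) nYb' hbb' hb'n
      · rw [card_insert_of_notMem hb'Y, cYbn]; omega
      · simp [hb'Y]; omega
      · simp [bY]; omega
    · refine Or.inr (Or.inl ⟨b', ?_, hbb', by rwa [insert_comm]⟩)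
      simp [hb'Y]; omega
  · have nV : n ∉ (insert b Y).erase c := fun h => nYb (mem_of_mem_erase h)
    have hcn : c ≠ n := by rintro rfl; exact nY hcY
    rcases (mem_delFam nV).1 hc with h | h
    · exfalso
      refine (hC.sep _ h _ hX).surrounds ?_ b c n ?_ bX (mem_insert_of_mem hcY) (by simp)
        (mem_insert_self _ _) nV hcb bn
      · rw [card_erase_of_mem (mem_insert_of_mem hcY), cYb, card_insert_of_notMem nY]; omega
      · simp; omega
    · refine Or.inr (Or.inr ⟨c, mem_insert_of_mem hcY, hcb, ?_⟩)
      rwa [insert_comm, erase_insert_of_ne hcn.symm]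

/-- Reflection `x ↦ n - x` of `{0, …, n}` followed by complementation. -/
def reflCompl (n : ℕ) (I : Finset ℕ) : Finset ℕ := (range (n + 1)).filter (fun x => n - x ∉ I)

lemma mem_reflCompl {n x : ℕ} {I : Finset ℕ} : x ∈ reflCompl n I ↔ x ≤ n ∧ n - x ∉ I := by
  simp [reflCompl]

lemma reflCompl_reflCompl {n : ℕ} {I : Finset ℕ} (hI : I ⊆ range (n + 1)) :
    reflCompl n (reflCompl n I) = I := by
  ext x
  simp only [mem_reflCompl, not_and, not_not]
  constructor
  · rintro ⟨h1, h2⟩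
    simpa [Nat.sub_sub_self h1] using h2 (Nat.sub_le _ _)
  · intro h
    have h1 : x ≤ n := Nat.lt_succ_iff.1 (mem_range.1 (hI h))
    exact ⟨h1, fun _ => by rwa [Nat.sub_sub_self h1]⟩

lemma reflCompl_subset (n : ℕ) (I : Finset ℕ) : reflCompl n I ⊆ range (n + 1) :=
  filter_subset _ _

lemma card_reflCompl {n : ℕ} {I : Finset ℕ} (hI : I ⊆ range (n + 1)) :
    #(reflCompl n I) + #I = n + 1 := by
  have h1 : #(reflCompl n I) = #(range (n + 1) \ I) := by
    refine card_bij (fun x _ => n - x) ?_ ?_ ?_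
    · intro x hx
      have := mem_reflCompl.1 hx
      simp [this.2]
    · intro x hx y hy h
      have h1 := (mem_reflCompl.1 hx).1
      have h2 := (mem_reflCompl.1 hy).1
      omega
    · intro y hy
      simp only [mem_sdiff, mem_range] at hy
      exact ⟨n - y,
        mem_reflCompl.2 ⟨Nat.sub_le _ _, by rw [Nat.sub_sub_self (by omega)]; exact hy.2⟩,
        by omega⟩
  have h2 := card_le_card hI
  rw [h1, card_sdiff_of_subset hI]
  rw [card_range] at *
  omega

lemma LZSep.reflCompl {n : ℕ} {I J : Finset ℕ} (hI : I ⊆ range (n + 1)) (hJ : J ⊆ range (n + 1))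
    (h : LZSep I J) : LZSep (reflCompl n I) (reflCompl n J) := by
  have c1 := card_reflCompl hI
  have c2 := card_reflCompl hJ
  have key : ∀ I J : Finset ℕ, Surrounds I J →
      Surrounds (_root_.reflCompl n J) (_root_.reflCompl n I) := by
    intro I J h i j j' h1 h2 h3 h4 h5 h6 h7 h8
    simp only [mem_reflCompl, not_and, not_not] at *
    exact h (n - i) (n - j') (n - j) (h2 h1.1) h1.2 (h6 h5.1) h5.2 (h4 h3.1) h3.2
      (by omega) (by omega)
  rcases h with ⟨h1, h2⟩ | ⟨h1, h2⟩
  · exact Or.inr ⟨by omega, key _ _ h2⟩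
  · exact Or.inl ⟨by omega, key _ _ h2⟩

lemma MaxLZ.refl_compl {n : ℕ} {C : Finset (Finset ℕ)} (hC : MaxLZ (n + 1) C) :
    MaxLZ (n + 1) (C.image (reflCompl n)) := by
  refine ⟨⟨?_, ?_⟩, ?_⟩
  · intro I hI
    obtain ⟨J, -, rfl⟩ := mem_image.1 hI
    exact reflCompl_subset _ _
  · intro I hI J hJ
    obtain ⟨I', hI', rfl⟩ := mem_image.1 hI
    obtain ⟨J', hJ', rfl⟩ := mem_image.1 hJ
    exact (hC.sep I' hI' J' hJ').reflCompl (hC.sub I' hI') (hC.sub J' hJ')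
  · rw [card_image_of_injOn]
    · exact hC.card_eq
    · intro I hI J hJ h
      have := congrArg (reflCompl n) h
      rwa [reflCompl_reflCompl (hC.sub I hI), reflCompl_reflCompl (hC.sub J hJ)] at this

lemma mem_image_reflCompl {n : ℕ} {C : Finset (Finset ℕ)} (hC : MaxLZ (n + 1) C) {I : Finset ℕ}
    (hI : I ⊆ range (n + 1)) : I ∈ C.image (reflCompl n) ↔ reflCompl n I ∈ C := by
  constructor
  · intro h
    obtain ⟨J, hJ, rfl⟩ := mem_image.1 h
    rwa [reflCompl_reflCompl (hC.sub J hJ)]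
  · intro h
    exact mem_image.2 ⟨_, h, reflCompl_reflCompl hI⟩

lemma reflCompl_insert {n b : ℕ} (hb : b ≤ n) (X : Finset ℕ) :
    reflCompl n (insert b X) = (reflCompl n X).erase (n - b) := by
  ext x
  simp only [mem_reflCompl, mem_insert, mem_erase, not_or]
  constructor
  · rintro ⟨h1, h2, h3⟩
    exact ⟨by omega, h1, h3⟩
  · rintro ⟨h1, h2, h3⟩
    exact ⟨h2, by omega, h3⟩

lemma MaxLZ.next_top {n : ℕ} {C : Finset (Finset ℕ)} (hC : MaxLZ (n + 1) C)
    (ih : ∀ C, MaxLZ n C → HasNext n C) {X : Finset ℕ} (nX : n ∉ X)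
    (hX : X ∈ C) (hXn : insert n X ∈ C) : X = Ioo n (n + 1) ∨
    (∃ b', b' ∉ X ∧ n < b' ∧ insert b' X ∈ C) ∨
    (∃ c ∈ X, c < n ∧ (insert n X).erase c ∈ C) := by
  have sX := hC.sub X hX
  rcases Nat.eq_zero_or_pos n with rfl | hn
  · left
    ext x
    have : x ∉ X := fun h => by
      have := sX h
      simp at this
      exact nX (this ▸ h)
    simp [this]
    omega
  set C' := C.image (reflCompl n) with hC'
  have mC' : MaxLZ (n + 1) C' := hC.refl_compl
  set Y := reflCompl n (insert n X) with hY
  have e1 : reflCompl n X = insert 0 Y := by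
    rw [hY, reflCompl_insert le_rfl, Nat.sub_self, insert_erase]
    exact mem_reflCompl.2 ⟨Nat.zero_le _, by simpa using nX⟩
  have zY : 0 ∉ Y := by rw [hY, mem_reflCompl]; simp
  have hY' : Y ∈ C' := mem_image_of_mem _ hXn
  have hY0 : insert 0 Y ∈ C' := e1 ▸ mem_image_of_mem _ hX
  have hr : reflCompl n Y = insert n X := reflCompl_reflCompl (hC.sub _ hXn)
  have main : Y = Ioo 0 (n + 1) ∨ (∃ b', b' ∉ Y ∧ 0 < b' ∧ insert b' Y ∈ C') ∨
      (∃ c ∈ Y, c < 0 ∧ (insert 0 Y).erase c ∈ C') := by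
    by_cases nY : n ∈ Y
    · exact mC'.next_of_mem (ih _ mC'.del) hn zY nY hY' hY0
    · exact mC'.next_of_notMem (ih _ mC'.del) hn zY nY hY' hY0
  rcases main with h | ⟨b', h1, h2, h3⟩ | ⟨c, -, h, -⟩
  · left
    have : insert n X = {n} := by
      rw [← hr, h]
      ext x
      simp only [mem_reflCompl, mem_Ioo, mem_singleton]
      omega
    have : X = ∅ := by
      rw [← erase_insert nX, this]
      simp
    rw [this]
    ext x
    simp
  · right; right
    have sb := mC'.sub _ h3
    have hb'n : b' ≤ n := by simpa [Nat.lt_succ_iff] using sb (mem_insert_self _ _)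
    rw [mem_image_reflCompl hC sb, reflCompl_insert hb'n, hr] at h3
    refine ⟨n - b', ?_, by omega, h3⟩
    have : n - b' ∈ insert n X := by
      by_contra hcon
      exact h1 (mem_reflCompl.2 ⟨hb'n, hcon⟩)
    exact mem_of_mem_insert_of_ne this (by omega)
  · omega

theorem MaxLZ.hasNext {n : ℕ} : ∀ {C : Finset (Finset ℕ)}, MaxLZ n C → HasNext n C := by
  induction n with
  | zero =>
    intro C hC X b _ _ h
    have := hC.sub _ h (mem_insert_self _ _)
    simp at this
  | succ n ih =>
    intro C hC X b bX hX hXb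
    have hb : b ≤ n := Nat.lt_succ_iff.1 (mem_range.1 (hC.sub _ hXb (mem_insert_self _ _)))
    rcases hb.lt_or_eq with hb | rfl
    · by_cases nX : n ∈ X
      · exact hC.next_of_mem (ih hC.del) hb bX nX hX hXb
      · exact hC.next_of_notMem (ih hC.del) hb bX nX hX hXb
    · exact hC.next_top (fun _ h => ih h) bX hX hXb

/-- A family of pairwise separated `k`-element subsets of `{0, …, n - 1}`. -/
structure LevelFam (n k : ℕ) (D : Finset (Finset ℕ)) : Prop extends LZFam n D where
  card_mem : ∀ I ∈ D, #I = k

/-- The union of an initial segment of length `a` and a final segment of length `b`. -/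
def endsSet (n a b : ℕ) : Finset ℕ := range a ∪ Ico (n - b) n

/-- The triangle `{(a, b) : a + b < m}`. -/
def triangle (m : ℕ) : Finset (Σ _ : ℕ, ℕ) := (range m).sigma fun a => range (m - a)

lemma mem_triangle {m : ℕ} {p : Σ _ : ℕ, ℕ} : p ∈ triangle m ↔ p.1 + p.2 < m := by
  simp only [triangle, mem_sigma, mem_range]
  omega

lemma two_mul_card_triangle (m : ℕ) : 2 * #(triangle m) = m * (m + 1) := by
  rw [triangle, card_sigma]
  induction m with
  | zero => simp
  | succ m ih =>
    rw [sum_range_succ']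
    simp only [card_range, Nat.add_sub_add_right, Nat.sub_zero] at *
    rw [mul_add, ih]
    ring

/-- The sets `endsSet n a b` with fewer than `k` elements. -/
def smallFam (n k : ℕ) : Finset (Finset ℕ) := (triangle k).image fun p => endsSet n p.1 p.2

/-- The intervals in `{0, …, n - 1}` with more than `n - m` elements. -/
def largeFam (n m : ℕ) : Finset (Finset ℕ) := (triangle m).image fun p => Ico p.1 (n - p.2)

lemma mem_endsSet {n a b x : ℕ} : x ∈ endsSet n a b ↔ x < a ∨ (n - b ≤ x ∧ x < n) := by
  simp [endsSet]

lemma card_endsSet {n a b : ℕ} (h : a + b ≤ n) : #(endsSet n a b) = a + b := by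
  rw [endsSet, card_union_of_disjoint, card_range, Nat.card_Ico]
  · omega
  · rw [disjoint_left]
    intro x
    simp only [mem_range, mem_Ico]
    omega

lemma endsSet_sep {n a b : ℕ} {J : Finset ℕ} (h : a + b ≤ n) (hJ : J ⊆ range n)
    (hc : a + b ≤ #J) : LZSep (endsSet n a b) J := by
  refine Or.inl ⟨by rwa [card_endsSet h], fun i j j' h1 h2 h3 h4 h5 h6 h7 h8 => ?_⟩
  have := mem_range.1 (hJ h5)
  simp only [mem_endsSet] at *
  omega

lemma sep_Ico {a c : ℕ} {J : Finset ℕ} (hc : #J ≤ c - a) : LZSep J (Ico a c) := by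
  refine Or.inl ⟨by simpa using hc, fun i j j' h1 h2 h3 h4 h5 h6 h7 h8 => ?_⟩
  simp only [mem_Ico] at *
  omega

lemma card_smallFam {n k : ℕ} (h : k ≤ n) : 2 * #(smallFam n k) = k * (k + 1) := by
  rw [smallFam, card_image_of_injOn, two_mul_card_triangle]
  rintro ⟨a, b⟩ h1 ⟨a', b'⟩ h2 he
  have h1 := mem_triangle.1 h1
  have h2 := mem_triangle.1 h2
  simp only at *
  have hm : ∀ x, (x < a ∨ (n - b ≤ x ∧ x < n)) ↔ (x < a' ∨ (n - b' ≤ x ∧ x < n)) := by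
    intro x
    rw [← mem_endsSet, ← mem_endsSet, he]
  have e1 : a = a' := by
    have i1 := hm a
    have i2 := hm a'
    omega
  have e2 : b = b' := by
    have := card_endsSet (n := n) (a := a) (b := b) (by omega)
    rw [he, card_endsSet (by omega)] at this
    omega
  subst e1 e2
  rfl

lemma card_largeFam {n m : ℕ} (h : m ≤ n) : 2 * #(largeFam n m) = m * (m + 1) := by
  rw [largeFam, card_image_of_injOn, two_mul_card_triangle]
  rintro ⟨a, b⟩ h1 ⟨a', b'⟩ h2 he
  have h1 := mem_triangle.1 h1
  have h2 := mem_triangle.1 h2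
  simp only at *
  have hm : ∀ x, (a ≤ x ∧ x < n - b) ↔ (a' ≤ x ∧ x < n - b') := by
    intro x
    rw [← mem_Ico, ← mem_Ico, he]
  have e1 : a = a' := by
    have i1 := hm a
    have i2 := hm a'
    omega
  have e2 : b = b' := by
    have i1 := hm (n - b - 1)
    have i2 := hm (n - b' - 1)
    omega
  subst e1 e2
  rfl

/-- The level family `D` with the small end sets and the large intervals added. -/
def completion (n k m : ℕ) (D : Finset (Finset ℕ)) : Finset (Finset ℕ) :=
  D ∪ smallFam n k ∪ largeFam n m

lemma mem_smallFam {n k : ℕ} {I : Finset ℕ} :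
    I ∈ smallFam n k ↔ ∃ a b, a + b < k ∧ I = endsSet n a b := by
  simp only [smallFam, mem_image, mem_triangle]
  exact ⟨fun ⟨p, h1, h2⟩ => ⟨p.1, p.2, h1, h2.symm⟩, fun ⟨a, b, h1, h2⟩ => ⟨⟨a, b⟩, h1, h2.symm⟩⟩

lemma mem_largeFam {n m : ℕ} {I : Finset ℕ} :
    I ∈ largeFam n m ↔ ∃ a b, a + b < m ∧ I = Ico a (n - b) := by
  simp only [largeFam, mem_image, mem_triangle]
  exact ⟨fun ⟨p, h1, h2⟩ => ⟨p.1, p.2, h1, h2.symm⟩, fun ⟨a, b, h1, h2⟩ => ⟨⟨a, b⟩, h1, h2.symm⟩⟩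

lemma card_lt_of_mem_smallFam {n k : ℕ} (h : k ≤ n) {I : Finset ℕ} (hI : I ∈ smallFam n k) :
    #I < k := by
  obtain ⟨a, b, hab, rfl⟩ := mem_smallFam.1 hI
  rwa [card_endsSet (by omega)]

lemma lt_card_of_mem_largeFam {k m : ℕ} {I : Finset ℕ} (hI : I ∈ largeFam (k + m) m) :
    k < #I := by
  obtain ⟨a, b, hab, rfl⟩ := mem_largeFam.1 hI
  rw [Nat.card_Ico]
  omega

lemma sep_of_mem_smallFam {n k : ℕ} (h : k ≤ n) {I J : Finset ℕ} (hI : I ∈ smallFam n k)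
    (hJ : J ⊆ range n) (hc : #I ≤ #J) : LZSep I J := by
  obtain ⟨a, b, hab, rfl⟩ := mem_smallFam.1 hI
  rw [card_endsSet (by omega)] at hc
  exact endsSet_sep (by omega) hJ hc

lemma sep_of_mem_largeFam {n m : ℕ} {I J : Finset ℕ} (hJ : J ∈ largeFam n m)
    (hc : #I ≤ #J) : LZSep I J := by
  obtain ⟨a, b, hab, rfl⟩ := mem_largeFam.1 hJ
  exact sep_Ico (by simpa using hc)

namespace LevelFam

variable {k m : ℕ} {D : Finset (Finset ℕ)}

lemma completion (hD : LevelFam (k + m) k D) : LZFam (k + m) (completion (k + m) k m D) := by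
  have hsub : ∀ I ∈ _root_.completion (k + m) k m D, I ⊆ range (k + m) := by
    intro I hI
    rcases mem_union.1 hI with hI | hI
    · rcases mem_union.1 hI with hI | hI
      · exact hD.sub I hI
      · obtain ⟨a, b, hab, rfl⟩ := mem_smallFam.1 hI
        intro x
        rw [mem_endsSet, mem_range]
        omega
    · obtain ⟨a, b, hab, rfl⟩ := mem_largeFam.1 hI
      intro x
      rw [mem_Ico, mem_range]
      omega
  have key : ∀ I ∈ _root_.completion (k + m) k m D, ∀ J ∈ _root_.completion (k + m) k m D,
      #I ≤ #J → LZSep I J := by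
    intro I hI J hJ hc
    have sJ := hsub J hJ
    rcases mem_union.1 hI with hI | hI
    · rcases mem_union.1 hI with hI | hI
      · rcases mem_union.1 hJ with hJ | hJ
        · rcases mem_union.1 hJ with hJ | hJ
          · exact hD.sep I hI J hJ
          · have := hD.card_mem I hI
            have := card_lt_of_mem_smallFam (by omega) hJ
            omega
        · exact sep_of_mem_largeFam hJ hc
      · exact sep_of_mem_smallFam (by omega) hI sJ hc
    · rcases mem_union.1 hJ with hJ | hJ
      · have h1 := lt_card_of_mem_largeFam hI
        rcases mem_union.1 hJ with hJ | hJ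
        · have := hD.card_mem J hJ
          omega
        · have := card_lt_of_mem_smallFam (by omega) hJ
          omega
      · exact sep_of_mem_largeFam hJ hc
  refine ⟨hsub, fun I hI J hJ => ?_⟩
  rcases le_total (#I) (#J) with h | h
  · exact key I hI J hJ h
  · exact (key J hJ I hI h).symm

lemma two_mul_card_completion (hD : LevelFam (k + m) k D) :
    2 * #(_root_.completion (k + m) k m D) = 2 * #D + k * (k + 1) + m * (m + 1) := by
  rw [_root_.completion, card_union_of_disjoint, card_union_of_disjoint, mul_add, mul_add,
    card_smallFam (by omega), card_largeFam (by omega)]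
  · rw [disjoint_left]
    intro I h1 h2
    have := hD.card_mem I h1
    have := card_lt_of_mem_smallFam (by omega) h2
    omega
  · rw [disjoint_left]
    intro I h1 h2
    have := lt_card_of_mem_largeFam h2
    rcases mem_union.1 h1 with h1 | h1
    · have := hD.card_mem I h1
      omega
    · have := card_lt_of_mem_smallFam (by omega) h1
      omega

/-- The purity bound. -/
theorem card_le (hD : LevelFam (k + m) k D) : #D ≤ k * m + 1 := by
  have h1 := hD.completion.two_mul_card_le
  rw [hD.two_mul_card_completion] at h1
  nlinarith

lemma maxLZ (hD : LevelFam (k + m) k D) (h : #D = k * m + 1) :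
    MaxLZ (k + m) (_root_.completion (k + m) k m D) := by
  refine ⟨hD.completion, ?_⟩
  rw [hD.two_mul_card_completion, h]
  ring

lemma mem_of_mem_completion {I : Finset ℕ}
    (hI : I ∈ _root_.completion (k + m) k m D) (hc : #I = k) : I ∈ D := by
  rcases mem_union.1 hI with hI | hI
  · rcases mem_union.1 hI with hI | hI
    · exact hI
    · have := card_lt_of_mem_smallFam (by omega) hI
      omega
  · have := lt_card_of_mem_largeFam hI
    omega

lemma mem_smallFam_of_card {I : Finset ℕ} (hD : LevelFam (k + m) k D)
    (hI : I ∈ _root_.completion (k + m) k m D) (hc : #I < k) : I ∈ smallFam (k + m) k := by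
  rcases mem_union.1 hI with hI | hI
  · rcases mem_union.1 hI with hI | hI
    · have := hD.card_mem I hI
      omega
    · exact hI
  · have := lt_card_of_mem_largeFam hI
    omega

lemma mem_largeFam_of_card {I : Finset ℕ} (hD : LevelFam (k + m) k D)
    (hI : I ∈ _root_.completion (k + m) k m D) (hc : k < #I) : I ∈ largeFam (k + m) m := by
  rcases mem_union.1 hI with hI | hI
  · rcases mem_union.1 hI with hI | hI
    · have := hD.card_mem I hI
      omega
    · have := card_lt_of_mem_smallFam (by omega) hI
      omega
  · exact hI

lemma endsSet_mem (hD : LevelFam (k + m) k D) (h : #D = k * m + 1) {a b : ℕ} (hab : a + b = k) :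
    endsSet (k + m) a b ∈ D := by
  refine mem_of_mem_completion ((hD.maxLZ h).mem_of_sep ?_ ?_) ?_ (m := m)
  · intro x
    rw [mem_endsSet, mem_range]
    omega
  · intro I hI
    have sI := hD.completion.sub I hI
    rcases le_or_gt k (#I) with hc | hc
    · exact (endsSet_sep (by omega) sI (by omega)).symm
    · refine sep_of_mem_smallFam (by omega) (hD.mem_smallFam_of_card hI hc) ?_ ?_
      · intro x
        rw [mem_endsSet, mem_range]
        omega
      · rw [card_endsSet (by omega)]
        omega
  · rw [card_endsSet (by omega), hab]

lemma Ico_mem (hD : LevelFam (k + m) k D) (h : #D = k * m + 1) {a c : ℕ} (hac : a + k = c)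
    (hc : c ≤ k + m) : Ico a c ∈ D := by
  have cI : #(Ico a c) = k := by rw [Nat.card_Ico]; omega
  refine mem_of_mem_completion ((hD.maxLZ h).mem_of_sep ?_ ?_) cI (m := m)
  · intro x
    rw [mem_Ico, mem_range]
    omega
  · intro I hI
    rcases le_or_gt (#I) k with hc | hc
    · exact sep_Ico (by omega)
    · exact (sep_of_mem_largeFam (hD.mem_largeFam_of_card hI hc) (by omega)).symm

/-- For a level family of maximal size, every pair of members `X ∪ {n}`, `X ∪ {b}` with `n` the
last element has a neighbouring pair. -/
theorem next {n : ℕ} (hD : LevelFam (k + m) k D) (h : #D = k * m + 1) (hn : k + m = n + 1)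
    {X : Finset ℕ} {b : ℕ} (nX : n ∉ X) (bX : b ∉ X) (hbn : b < n) (hXn : insert n X ∈ D)
    (hXb : insert b X ∈ D) : X = Ioo b n ∨
    (∃ b', b' ∉ X ∧ b < b' ∧ b' < n ∧ insert b' X ∈ D) ∨
    (∃ c ∈ X, c < b ∧ insert n ((insert b X).erase c) ∈ D) := by
  have hmax := hD.maxLZ h
  set C := _root_.completion (k + m) k m D with hCdef
  have hDC : D ⊆ C := fun I hI => mem_union_left _ (mem_union_left _ hI)
  rw [hn] at hmax
  have nXb : n ∉ insert b X := by simp [nX]; omega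
  have cX : #X + 1 = k := by
    rw [← hD.card_mem _ hXb, card_insert_of_notMem bX]
  rcases hmax.del.hasNext X b bX ((mem_delFam nX).2 (Or.inr (hDC hXn)))
    ((mem_delFam nXb).2 (Or.inl (hDC hXb))) with h1 | ⟨b', h1, h2, h3⟩ | ⟨c, h1, h2, h3⟩
  · exact Or.inl h1
  · have hb'n : b' < n := by
      simpa using hmax.del.sub _ h3 (mem_insert_self _ _)
    have nX' : n ∉ insert b' X := by simp [nX]; omega
    have cX' : #(insert b' X) = k := by rw [card_insert_of_notMem h1, cX]
    refine Or.inr (Or.inl ⟨b', h1, h2, hb'n, ?_⟩)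
    rcases (mem_delFam nX').1 h3 with h4 | h4
    · exact mem_of_mem_completion h4 cX'
    · have c1 : #(insert n (insert b' X)) = k + 1 := by rw [card_insert_of_notMem nX', cX']
      obtain ⟨α, β, hαβ, he⟩ := mem_largeFam.1 (hD.mem_largeFam_of_card h4 (by omega))
      have hmem : n ∈ Ico α (k + m - β) := by rw [← he]; exact mem_insert_self _ _
      rw [mem_Ico] at hmem
      have he' : insert b' X = Ico α n := by
        rw [← erase_insert nX', he]
        ext x
        simp only [mem_erase, mem_Ico]
        omega
      rw [he']
      refine hD.Ico_mem h ?_ (by omega)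
      rw [he', Nat.card_Ico] at cX'
      omega
  · have nV : n ∉ (insert b X).erase c := fun h => nXb (mem_of_mem_erase h)
    have cV : #((insert b X).erase c) + 1 = k := by
      rw [card_erase_of_mem (mem_insert_of_mem h1), card_insert_of_notMem bX]
      omega
    refine Or.inr (Or.inr ⟨c, h1, h2, ?_⟩)
    rcases (mem_delFam nV).1 h3 with h4 | h4
    · obtain ⟨α, β, hαβ, he⟩ := mem_smallFam.1 (hD.mem_smallFam_of_card h4 (by omega))
      rw [he] at nV cV ⊢
      rw [mem_endsSet] at nV
      have hβ : β = 0 := by omega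
      subst hβ
      rw [card_endsSet (by omega)] at cV
      have : insert n (endsSet (k + m) α 0) = endsSet (k + m) α 1 := by
        ext x
        simp only [mem_insert, mem_endsSet]
        omega
      rw [this]
      exact hD.endsSet_mem h (by omega)
    · exact mem_of_mem_completion h4 (by rw [card_insert_of_notMem nV, cV])

end LevelFam

section Cyclic

variable {n : ℕ}

/-- The clockwise distance from `u` to `x` in `ℤ/n`. -/
def off (u x : ZMod n) : ℕ := (x - u).val

lemma off_self (u : ZMod n) : off u u = 0 := by simp [off]

lemma off_eq_zero {u x : ZMod n} : off u x = 0 ↔ x = u := by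
  rw [off, ZMod.val_eq_zero, sub_eq_zero]

lemma off_add_add (u x t : ZMod n) : off (u + t) (x + t) = off u x := by
  simp [off]

lemma off_add_natCast {i : ℕ} (hi : i < n) (u : ZMod n) : off u (u + i) = i := by
  simp [off, ZMod.val_natCast, Nat.mod_eq_of_lt hi]

variable [NeZero n]

lemma off_lt (u x : ZMod n) : off u x < n := ZMod.val_lt _

lemma off_add_off (u a b : ZMod n) :
    off u a + off a b = off u b ∨ off u a + off a b = off u b + n := by
  have h : b - u = (a - u) + (b - a) := by ring
  unfold off
  rw [h]
  rcases lt_or_ge ((a - u).val + (b - a).val) n with h1 | h1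
  · left
    rw [ZMod.val_add_of_lt h1]
  · right
    rw [ZMod.val_add_val_of_le h1]

lemma off_injective (u : ZMod n) : Function.Injective (off u) := fun x y h => by
  have := ZMod.val_injective n h
  simpa using this

lemma off_add_off_swap {a b : ZMod n} (h : a ≠ b) : off a b + off b a = n := by
  have h1 := off_add_off a b a
  have h2 := off_lt a b
  have h3 : off a b ≠ 0 := fun h' => h (off_eq_zero.1 h').symm
  rw [off_self] at h1
  omega

/-- `off u` as an embedding. -/
def offEmb (u : ZMod n) : ZMod n ↪ ℕ := ⟨off u, off_injective u⟩

/-- `c` lies strictly between `a` and `b` on the clockwise arc from `a` to `b`. -/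
def InArc (a c b : ZMod n) : Prop := c ≠ a ∧ off a c < off a b

/-- There are four cyclically ordered points alternating between `S \ T` and `T \ S`. -/
def Crossing (S T : Finset (ZMod n)) : Prop :=
  ∃ a b c d, (a ∈ S ∧ a ∉ T) ∧ (b ∈ T ∧ b ∉ S) ∧ (c ∈ S ∧ c ∉ T) ∧ (d ∈ T ∧ d ∉ S) ∧
    off a b < off a c ∧ off a c < off a d

lemma Crossing.symm {S T : Finset (ZMod n)} (h : Crossing S T) : Crossing T S := by
  obtain ⟨a, b, c, d, ha, hb, hc, hd, h1, h2⟩ := h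
  refine ⟨b, c, d, a, hb, hc, hd, ha, ?_, ?_⟩
  · have := off_add_off a b c
    have := off_add_off a b d
    have := off_lt b c
    have := off_lt b d
    have := off_lt a c
    have := off_lt a d
    omega
  · have := off_add_off a b d
    have := off_add_off a b a
    have h3 : off a b ≠ 0 := fun h => hb.2 (off_eq_zero.1 h ▸ ha.1)
    rw [off_self] at *
    have := off_lt b a
    have := off_lt b d
    have := off_lt a d
    omega

lemma crossing_of_base (u : ZMod n) {S T : Finset (ZMod n)} {a b c d : ZMod n}
    (ha : a ∈ S ∧ a ∉ T) (hb : b ∈ T ∧ b ∉ S) (hc : c ∈ S ∧ c ∉ T) (hd : d ∈ T ∧ d ∉ S)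
    (h1 : off u a < off u b) (h2 : off u b < off u c) (h3 : off u c < off u d) :
    Crossing S T := by
  refine ⟨a, b, c, d, ha, hb, hc, hd, ?_, ?_⟩
  · have := off_add_off u a b
    have := off_add_off u a c
    have := off_lt u b
    have := off_lt u c
    have := off_lt a c
    have := off_lt a b
    omega
  · have := off_add_off u a c
    have := off_add_off u a d
    have := off_lt u c
    have := off_lt u d
    have := off_lt a c
    have := off_lt a d
    omega

lemma Crossing.exists_base (u : ZMod n) {S T : Finset (ZMod n)} (h : Crossing S T) :
    ∃ a b c d, off u a < off u b ∧ off u b < off u c ∧ off u c < off u d ∧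
      (((a ∈ S ∧ a ∉ T) ∧ (b ∈ T ∧ b ∉ S) ∧ (c ∈ S ∧ c ∉ T) ∧ (d ∈ T ∧ d ∉ S)) ∨
       ((a ∈ T ∧ a ∉ S) ∧ (b ∈ S ∧ b ∉ T) ∧ (c ∈ T ∧ c ∉ S) ∧ (d ∈ S ∧ d ∉ T))) := by
  obtain ⟨a, b, c, d, ha, hb, hc, hd, h1, h2⟩ := h
  have h3 : off a b ≠ 0 := fun h => hb.2 (off_eq_zero.1 h ▸ ha.1)
  have e1 := off_add_off u a b
  have e2 := off_add_off u a c
  have e3 := off_add_off u a d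
  have l1 := off_lt u a
  have l2 := off_lt u b
  have l3 := off_lt u c
  have l4 := off_lt u d
  have l5 := off_lt a d
  by_cases k1 : off u a + off a b < n
  · by_cases k2 : off u a + off a c < n
    · by_cases k3 : off u a + off a d < n
      · exact ⟨a, b, c, d, by omega, by omega, by omega, Or.inl ⟨ha, hb, hc, hd⟩⟩
      · exact ⟨d, a, b, c, by omega, by omega, by omega, Or.inr ⟨hd, ha, hb, hc⟩⟩
    · exact ⟨c, d, a, b, by omega, by omega, by omega, Or.inl ⟨hc, hd, ha, hb⟩⟩
  · exact ⟨b, c, d, a, by omega, by omega, by omega, Or.inr ⟨hb, hc, hd, ha⟩⟩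

/-- A family of pairwise non-crossing `k`-element subsets of `ℤ/n`. -/
structure CycFam (n : ℕ) [NeZero n] (k : ℕ) (D : Finset (Finset (ZMod n))) : Prop where
  card_mem : ∀ I ∈ D, #I = k
  noncross : ∀ I ∈ D, ∀ J ∈ D, ¬ Crossing I J

/-- The family `D` in linear coordinates starting from `u`. -/
def unroll (u : ZMod n) (D : Finset (Finset (ZMod n))) : Finset (Finset ℕ) :=
  D.map (mapEmbedding (offEmb u)).toEmbedding

lemma map_mem_unroll {u : ZMod n} {D : Finset (Finset (ZMod n))} {I : Finset (ZMod n)} :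
    I.map (offEmb u) ∈ unroll u D ↔ I ∈ D := by
  unfold unroll
  exact mem_map' (mapEmbedding (offEmb u)).toEmbedding

lemma off_mem_map {u x : ZMod n} {I : Finset (ZMod n)} : off u x ∈ I.map (offEmb u) ↔ x ∈ I :=
  mem_map' (offEmb u)

lemma exists_map_of_mem_unroll {u : ZMod n} {D : Finset (Finset (ZMod n))} {I : Finset ℕ}
    (h : I ∈ unroll u D) : ∃ J ∈ D, I = J.map (offEmb u) := by
  obtain ⟨J, hJ, rfl⟩ := mem_map.1 h
  exact ⟨J, hJ, rfl⟩

lemma exists_off_of_mem_map {u : ZMod n} {I : Finset (ZMod n)} {i : ℕ}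
    (h : i ∈ I.map (offEmb u)) : ∃ x ∈ I, off u x = i := mem_map.1 h

lemma lzSep_of_not_crossing (u : ZMod n) {I J : Finset (ZMod n)} (hc : #I = #J)
    (h : ¬ Crossing I J) : LZSep (I.map (offEmb u)) (J.map (offEmb u)) := by
  by_contra hcon
  rw [LZSep, card_map, card_map] at hcon
  simp only [hc, le_refl, true_and, not_or] at hcon
  obtain ⟨h1, h2⟩ := hcon
  simp only [Surrounds, not_forall] at h1 h2
  obtain ⟨i, j, j', hi, hiJ, hj, hjI, hj', hjI', h3, h4, -⟩ := h1
  obtain ⟨y, x, x', hy, hyI, hx, hxJ, hx', hxJ', h5, h6, -⟩ := h2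
  obtain ⟨i, -, rfl⟩ := exists_off_of_mem_map hi
  obtain ⟨j, -, rfl⟩ := exists_off_of_mem_map hj
  obtain ⟨j', -, rfl⟩ := exists_off_of_mem_map hj'
  obtain ⟨y, -, rfl⟩ := exists_off_of_mem_map hy
  obtain ⟨x, -, rfl⟩ := exists_off_of_mem_map hx
  obtain ⟨x', -, rfl⟩ := exists_off_of_mem_map hx'
  rw [off_mem_map] at hi hiJ hj hjI hj' hjI' hy hyI hx hxJ hx' hxJ'
  rcases lt_trichotomy (off u y) (off u i) with h7 | h7 | h7
  · exact h (crossing_of_base u ⟨hx, hxJ⟩ ⟨hy, hyI⟩ ⟨hi, hiJ⟩ ⟨hj', hjI'⟩ h5 h7 h4)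
  · exact hyI (off_injective u h7 ▸ hi)
  · exact h (crossing_of_base u ⟨hj, hjI⟩ ⟨hi, hiJ⟩ ⟨hy, hyI⟩ ⟨hx', hxJ'⟩ h3 h7 h6).symm

namespace CycFam

variable {k m : ℕ} {D : Finset (Finset (ZMod n))}

lemma unroll (hD : CycFam n k D) (u : ZMod n) : LevelFam n k (unroll u D) := by
  refine ⟨⟨?_, ?_⟩, ?_⟩
  · intro I hI i hi
    obtain ⟨J, hJ, rfl⟩ := exists_map_of_mem_unroll hI
    obtain ⟨x, hx, rfl⟩ := exists_off_of_mem_map hi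
    exact mem_range.2 (off_lt _ _)
  · intro I hI J hJ
    obtain ⟨I, hI', rfl⟩ := exists_map_of_mem_unroll hI
    obtain ⟨J, hJ', rfl⟩ := exists_map_of_mem_unroll hJ
    exact lzSep_of_not_crossing u (by rw [hD.card_mem I hI', hD.card_mem J hJ'])
      (hD.noncross I hI' J hJ')
  · intro I hI
    obtain ⟨I, hI', rfl⟩ := exists_map_of_mem_unroll hI
    rw [card_map, hD.card_mem I hI']

theorem card_le (hD : CycFam n k D) (hn : k + m = n) : #D ≤ k * m + 1 := by
  subst hn
  have := (hD.unroll 0).card_le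
  rwa [_root_.unroll, card_map] at this

/-- The neighbour trichotomy in cyclic form. -/
theorem next (hD : CycFam n k D) (hn : k + m = n) (h : #D = k * m + 1)
    {X : Finset (ZMod n)} {a b : ZMod n} (hab : a ≠ b) (aX : a ∉ X) (bX : b ∉ X)
    (hXa : insert a X ∈ D) (hXb : insert b X ∈ D) : (∀ c, c ∈ X ↔ InArc b c a) ∨
    (∃ c, c ∉ X ∧ InArc b c a ∧ insert c X ∈ D) ∨
    (∃ c ∈ X, InArc a c b ∧ (insert b (insert a X)).erase c ∈ D) := by
  subst hn
  set u : ZMod (k + m) := a + 1 with hu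
  obtain ⟨n, hn⟩ : ∃ n, k + m = n + 1 := ⟨k + m - 1, by have := NeZero.ne (k + m); omega⟩
  have hua : off u a = n := by
    have h1 : a = u + (n : ℕ) := by
      have : ((n + 1 : ℕ) : ZMod (k + m)) = 0 := by rw [← hn]; exact ZMod.natCast_self _
      push_cast at this
      rw [hu, add_assoc, add_comm 1, this, add_zero]
    rw [h1]
    exact off_add_natCast (by omega) _
  have hlt : ∀ x, x ≠ a → off u x < n := by
    intro x hx
    have h1 := off_lt u x
    have h2 : off u x ≠ n := fun h => hx (off_injective u (h.trans hua.symm))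
    omega
  have hArc : ∀ c, InArc b c a ↔ off u b < off u c ∧ off u c < n := by
    intro c
    have e1 := off_add_off u b c
    have e2 := off_add_off u b a
    have l1 := off_lt u b
    have l2 := off_lt u c
    have l3 := off_lt b c
    have l4 := off_lt b a
    have e3 : c ≠ b ↔ off b c ≠ 0 := not_congr off_eq_zero.symm
    have := hlt b hab.symm
    rw [InArc, e3]
    omega
  have hArc' : ∀ c, c ≠ a → off u c < off u b → InArc a c b := by
    intro c hc hcb
    refine ⟨hc, ?_⟩
    have e1 := off_add_off u a c
    have e2 := off_add_off u a b
    have l3 := off_lt a c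
    have l4 := off_lt a b
    have := hlt c hc
    have := hlt b hab.symm
    omega
  have hcard : #(_root_.unroll u D) = k * m + 1 := by rw [_root_.unroll, card_map, h]
  have hins : ∀ (x : ZMod (k + m)) (X : Finset (ZMod (k + m))),
      insert (off u x) (X.map (offEmb u)) = (insert x X).map (offEmb u) :=
    fun x X => (map_insert (offEmb u) x X).symm
  rcases (hD.unroll u).next hcard hn (X := X.map (offEmb u)) (b := off u b)
    (by rwa [← hua, off_mem_map]) (by rwa [off_mem_map]) (hlt b hab.symm)
    (by rwa [← hua, hins, map_mem_unroll]) (by rwa [hins, map_mem_unroll]) with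
    h1 | ⟨c, h1, h2, h3, h4⟩ | ⟨c, h1, h2, h3⟩
  · left
    intro c
    rw [← off_mem_map (u := u), h1, mem_Ioo, hArc]
  · right; left
    have hc : off u (u + (c : ℕ)) = c := off_add_natCast (by omega) _
    rw [← hc] at h1 h2 h3 h4
    rw [off_mem_map] at h1
    rw [hins, map_mem_unroll] at h4
    exact ⟨_, h1, (hArc _).2 ⟨h2, h3⟩, h4⟩
  · right; right
    obtain ⟨c, hcX, rfl⟩ := exists_off_of_mem_map h1
    have hca : c ≠ a := by rintro rfl; exact aX hcX
    refine ⟨c, hcX, hArc' c hca h2, ?_⟩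
    rw [← hua, hins] at h3
    have e : ((insert b X).map (offEmb u)).erase (off u c) =
        ((insert b X).erase c).map (offEmb u) := (map_erase (offEmb u) _ _).symm
    rw [e, hins, map_mem_unroll] at h3
    rwa [insert_comm, erase_insert_of_ne hca.symm]

lemma not_both (hD : CycFam n k D) {X : Finset (ZMod n)} {a b c c' : ZMod n} (hab : a ≠ b)
    (aX : a ∉ X) (bX : b ∉ X) (hc : c ∉ X) (hbc : InArc b c a) (hXc : insert c X ∈ D)
    (hc' : c' ∈ X) (hac : InArc a c' b) (hXc' : (insert b (insert a X)).erase c' ∈ D) : False := by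
  have hac' : a ≠ c' := by rintro rfl; exact aX hc'
  have hbc' : b ≠ c' := by rintro rfl; exact bX hc'
  have hcc' : c ≠ c' := by rintro rfl; exact hc hc'
  have hca : c ≠ a := by rintro rfl; exact lt_irrefl _ hbc.2
  refine hD.noncross _ hXc' _ hXc ⟨a, c', b, c, ?_, ?_, ?_, ?_, hac.2, ?_⟩
  · simp [aX, hac', hca.symm]
  · simp [hc']
  · simp [bX, hbc', hbc.1.symm]
  · simp [hc, hca, hbc.1]
  · have e1 := off_add_off a b c
    have e2 := off_add_off a b a
    have e3 := off_self a
    have e4 : off b c ≠ 0 := fun h => hbc.1 (off_eq_zero.1 h)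
    have := hbc.2
    have := off_lt b a
    have := off_lt a c
    have := off_lt a b
    omega

end CycFam

end Cyclic

section Counting

variable {n : ℕ} [NeZero n]

open scoped Classical in
/-- Ordered pairs of cyclically consecutive distinct elements of `A`. -/
noncomputable def consec (A : Finset (ZMod n)) : Finset (ZMod n × ZMod n) :=
  (A ×ˢ A).filter fun p => p.1 ≠ p.2 ∧ ∀ c ∈ A, ¬ InArc p.1 c p.2

lemma mem_consec {A : Finset (ZMod n)} {p : ZMod n × ZMod n} :
    p ∈ consec A ↔ (p.1 ∈ A ∧ p.2 ∈ A) ∧ p.1 ≠ p.2 ∧ ∀ c ∈ A, ¬ InArc p.1 c p.2 := by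
  simp [consec]

lemma sum_consec_fst {A : Finset (ZMod n)} (hA : 2 ≤ #A) (f : ZMod n → ℤ) :
    ∑ p ∈ consec A, f p.1 = ∑ a ∈ A, f a := by
  refine sum_nbij Prod.fst (fun p hp => (mem_consec.1 hp).1.1) ?_ ?_ (fun _ _ => rfl)
  · rintro ⟨a, b⟩ h1 ⟨a', b'⟩ h2 h
    obtain ⟨⟨ha, hb⟩, hab, h1⟩ := mem_consec.1 h1
    obtain ⟨⟨-, hb'⟩, hab', h2⟩ := mem_consec.1 h2
    simp only at *
    subst h
    rcases lt_trichotomy (off a b) (off a b') with h | h | h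
    · exact absurd ⟨hab.symm, h⟩ (h2 b hb)
    · rw [off_injective a h]
    · exact absurd ⟨hab'.symm, h⟩ (h1 b' hb')
  · intro a ha
    obtain ⟨b', hb', hne⟩ := exists_mem_ne (by omega : 1 < #A) a
    obtain ⟨b, hb, hmin⟩ := exists_min_image (A.erase a) (off a) ⟨b', mem_erase.2 ⟨hne, hb'⟩⟩
    obtain ⟨hba, hbA⟩ := mem_erase.1 hb
    refine ⟨(a, b), mem_consec.2 ⟨⟨ha, hbA⟩, hba.symm, ?_⟩, rfl⟩
    rintro c hc ⟨h1, h2⟩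
    exact absurd (hmin c (mem_erase.2 ⟨h1, hc⟩)) (not_le.2 h2)

lemma inArc_of_off_lt {a a' b : ZMod n} (h1 : a ≠ a') (h : off a b < off a' b) :
    InArc a' a b ∨ a = b := by
  by_cases hab : a = b
  · exact Or.inr hab
  · refine Or.inl ⟨h1, ?_⟩
    have := off_add_off a' a b
    have := off_lt a' a
    have : off a b ≠ 0 := fun h => hab (off_eq_zero.1 h).symm
    omega

lemma off_lt_of_inArc {a b c : ZMod n} (h : InArc a c b) : off c b < off a b := by
  obtain ⟨h1, h2⟩ := h
  have := off_add_off a c b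
  have := off_lt a b
  have := off_lt c b
  have : off a c ≠ 0 := fun h => h1 (off_eq_zero.1 h)
  omega

lemma off_injective_left (u : ZMod n) : Function.Injective (fun x => off x u) := fun x y h => by
  have := ZMod.val_injective n h
  simpa using this

lemma sum_consec_snd {A : Finset (ZMod n)} (hA : 2 ≤ #A) (f : ZMod n → ℤ) :
    ∑ p ∈ consec A, f p.2 = ∑ a ∈ A, f a := by
  refine sum_nbij Prod.snd (fun p hp => (mem_consec.1 hp).1.2) ?_ ?_ (fun _ _ => rfl)
  · rintro ⟨a, b⟩ h1 ⟨a', b'⟩ h2 h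
    obtain ⟨⟨ha, hb⟩, hab, h1⟩ := mem_consec.1 h1
    obtain ⟨⟨ha', hb'⟩, hab', h2⟩ := mem_consec.1 h2
    simp only at *
    subst h
    by_contra hne
    have hne : a ≠ a' := fun h => hne (by rw [h])
    rcases lt_trichotomy (off a b) (off a' b) with h | h | h
    · exact (inArc_of_off_lt hne h).elim (h2 a ha) hab
    · exact hne (off_injective_left b h)
    · exact (inArc_of_off_lt hne.symm h).elim (h1 a' ha') hab'
  · intro b hb
    obtain ⟨a', ha', hne⟩ := exists_mem_ne (by omega : 1 < #A) b
    obtain ⟨a, ha, hmin⟩ :=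
      exists_min_image (A.erase b) (fun x => off x b) ⟨a', mem_erase.2 ⟨hne, ha'⟩⟩
    obtain ⟨hab, haA⟩ := mem_erase.1 ha
    refine ⟨(a, b), mem_consec.2 ⟨⟨haA, hb⟩, hab, ?_⟩, rfl⟩
    intro c hc h
    have hcb : c ≠ b := by
      rintro rfl
      exact lt_irrefl _ h.2
    have h1 := hmin c (mem_erase.2 ⟨hcb, hc⟩)
    have h2 : off c b < off a b := off_lt_of_inArc h
    omega

lemma sum_consec_off {A : Finset (ZMod n)} (hA : 2 ≤ #A) :
    ∑ p ∈ consec A, (off p.1 p.2 : ℤ) = n := by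
  obtain ⟨u, hu⟩ : A.Nonempty := card_pos.1 (by omega)
  have h : ∀ p ∈ consec A, (off p.1 p.2 : ℤ) =
      (off u p.2 + if p.2 = u then (n : ℤ) else 0) - off u p.1 := by
    intro p hp
    obtain ⟨-, hab, h1⟩ := mem_consec.1 hp
    have e1 := off_add_off u p.1 p.2
    have l1 := off_lt u p.1
    have l2 := off_lt p.1 p.2
    split_ifs with h2
    · have h3 : off u p.2 = 0 := off_eq_zero.2 h2
      have h4 : off u p.1 ≠ 0 := fun h => hab ((off_eq_zero.1 h).trans h2.symm)
      omega
    · by_contra hcon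
      have e2 := off_add_off u p.1 u
      rw [off_self] at e2
      have h3 : off u p.2 ≠ 0 := fun h => h2 (off_eq_zero.1 h)
      have l3 := off_lt p.1 u
      have h4 : u ≠ p.1 := by
        intro h
        rw [← h, off_self] at hcon
        simp at hcon
      exact h1 u hu ⟨h4, by omega⟩
  rw [sum_congr rfl h, sum_sub_distrib, sum_consec_fst hA (fun a => (off u a : ℤ)),
    sum_consec_snd hA (fun b => (off u b : ℤ) + if b = u then (n : ℤ) else 0), sum_add_distrib,
    sum_ite_eq' A u, if_pos hu]
  ring

lemma consec_eq_empty {A : Finset (ZMod n)} (hA : ¬ 2 ≤ #A) : consec A = ∅ := by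
  rw [eq_empty_iff_forall_notMem]
  intro p hp
  obtain ⟨⟨h1, h2⟩, h3, -⟩ := mem_consec.1 hp
  exact h3 (card_le_one.1 (by omega : #A ≤ 1) _ h1 _ h2)

/-- The antisymmetric weight of a pair of points. -/
def wt (a b : ZMod n) : ℤ := if a = b then 0 else 2 * off a b - n

lemma wt_swap (a b : ZMod n) : wt b a = -wt a b := by
  unfold wt
  by_cases h : a = b
  · simp [h]
  · rw [if_neg h, if_neg (Ne.symm h)]
    have := off_add_off_swap h
    omega

/-- The antisymmetric weight of a pair of sets. -/
def setWt (I J : Finset (ZMod n)) : ℤ := ∑ i ∈ I, ∑ j ∈ J, wt i j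

lemma setWt_swap (I J : Finset (ZMod n)) : setWt J I = -setWt I J := by
  rw [setWt, setWt, sum_comm, ← sum_neg_distrib]
  refine sum_congr rfl fun i _ => ?_
  rw [← sum_neg_distrib]
  exact sum_congr rfl fun j _ => wt_swap i j

lemma setWt_self (I : Finset (ZMod n)) : setWt I I = 0 := by
  have := setWt_swap I I
  omega

lemma setWt_insert {X : Finset (ZMod n)} {a b : ZMod n} (ha : a ∉ X) (hb : b ∉ X) :
    setWt (insert a X) (insert b X) = ∑ i ∈ X, wt i b - ∑ i ∈ X, wt i a + wt a b := by
  have h0 := setWt_self X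
  unfold setWt at *
  rw [sum_insert ha]
  simp only [sum_insert hb, sum_add_distrib, h0]
  have : ∑ j ∈ X, wt a j = -∑ i ∈ X, wt i a := by
    rw [← sum_neg_distrib]
    exact sum_congr rfl fun j _ => wt_swap j a
  rw [this]
  ring

lemma setWt_erase {Y : Finset (ZMod n)} {a b : ZMod n} (ha : a ∈ Y) (hb : b ∈ Y) :
    setWt (Y.erase a) (Y.erase b) = ∑ i ∈ Y, wt i a - ∑ i ∈ Y, wt i b + wt a b := by
  have h0 := setWt_self Y
  unfold setWt at *
  have h1 : ∀ i, ∑ j ∈ Y.erase b, wt i j = ∑ j ∈ Y, wt i j - wt i b := fun i => by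
    rw [← add_sum_erase Y _ hb]; ring
  simp only [h1, sum_sub_distrib]
  have h2 := add_sum_erase Y (fun i => ∑ j ∈ Y, wt i j) ha
  have h3 := add_sum_erase Y (fun i => wt i b) ha
  have : ∑ j ∈ Y, wt a j = -∑ i ∈ Y, wt i a := by
    rw [← sum_neg_distrib]
    exact sum_congr rfl fun j _ => wt_swap j a
  linarith

lemma sum_consec_wt (A : Finset (ZMod n)) (f : ZMod n → ℤ) :
    ∑ p ∈ consec A, (f p.2 - f p.1 + wt p.1 p.2) =
      n * (2 * (if 2 ≤ #A then 1 else 0) - #(consec A)) := by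
  split_ifs with hA
  · have h : ∀ p ∈ consec A, f p.2 - f p.1 + wt p.1 p.2 =
        f p.2 - f p.1 + (2 * (off p.1 p.2 : ℤ) - n) := by
      intro p hp
      rw [wt, if_neg (mem_consec.1 hp).2.1]
    rw [sum_congr rfl h, sum_add_distrib, sum_sub_distrib, sum_sub_distrib, sum_consec_fst hA,
      sum_consec_snd hA, ← mul_sum, sum_consec_off hA, sum_const, nsmul_eq_mul]
    ring
  · rw [consec_eq_empty hA]
    simp

end Counting

section Identity

variable {n : ℕ}

/-- The elements that can be removed from `Y` to give a member of `D`. -/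
def downSet (D : Finset (Finset (ZMod n))) (Y : Finset (ZMod n)) : Finset (ZMod n) :=
  Y.filter fun a => Y.erase a ∈ D

lemma mem_downSet {D : Finset (Finset (ZMod n))} {Y : Finset (ZMod n)} {a : ZMod n} :
    a ∈ downSet D Y ↔ a ∈ Y ∧ Y.erase a ∈ D := by
  simp [downSet]

variable [NeZero n]

/-- The elements that can be added to `X` to give a member of `D`. -/
def upSet (D : Finset (Finset (ZMod n))) (X : Finset (ZMod n)) : Finset (ZMod n) :=
  univ.filter fun a => a ∉ X ∧ insert a X ∈ D

lemma mem_upSet {D : Finset (Finset (ZMod n))} {X : Finset (ZMod n)} {a : ZMod n} :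
    a ∈ upSet D X ↔ a ∉ X ∧ insert a X ∈ D := by
  simp [upSet]

/-- Triples `(X, a, b)` such that `X ∪ {a}` and `X ∪ {b}` are distinct `k`-sets in `D`. -/
def exchanges (D : Finset (Finset (ZMod n))) : Finset (Finset (ZMod n) × ZMod n × ZMod n) :=
  univ.filter fun t => t.2.1 ≠ t.2.2 ∧ (t.2.1 ∉ t.1 ∧ insert t.2.1 t.1 ∈ D) ∧
    (t.2.2 ∉ t.1 ∧ insert t.2.2 t.1 ∈ D)

lemma mem_exchanges {D : Finset (Finset (ZMod n))} {t : Finset (ZMod n) × ZMod n × ZMod n} :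
    t ∈ exchanges D ↔ t.2.1 ≠ t.2.2 ∧ (t.2.1 ∉ t.1 ∧ insert t.2.1 t.1 ∈ D) ∧
    (t.2.2 ∉ t.1 ∧ insert t.2.2 t.1 ∈ D) := by
  simp [exchanges]

/-- The weight of an exchange. -/
def exWt (t : Finset (ZMod n) × ZMod n × ZMod n) : ℤ :=
  setWt (insert t.2.1 t.1) (insert t.2.2 t.1)

/-- Interchange the two added elements. -/
def exSwap (t : Finset (ZMod n) × ZMod n × ZMod n) : Finset (ZMod n) × ZMod n × ZMod n :=
  (t.1, t.2.2, t.2.1)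

/-- Some element on the arc between the two added elements can also be added. -/
def HasUp (D : Finset (Finset (ZMod n))) (t : Finset (ZMod n) × ZMod n × ZMod n) : Prop :=
  ∃ c ∈ upSet D t.1, InArc t.2.1 c t.2.2

/-- Some element on the arc between the two added elements can be removed after adding both. -/
def HasDown (D : Finset (Finset (ZMod n))) (t : Finset (ZMod n) × ZMod n × ZMod n) : Prop :=
  ∃ c ∈ downSet D (insert t.2.2 (insert t.2.1 t.1)), InArc t.2.1 c t.2.2

/-- The common part of the exchange is the full arc from the second to the first element. -/
def IsBdry (t : Finset (ZMod n) × ZMod n × ZMod n) : Prop :=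
  ∀ c, c ∈ t.1 ↔ InArc t.2.2 c t.2.1

lemma exSwap_mem {D : Finset (Finset (ZMod n))} {t : Finset (ZMod n) × ZMod n × ZMod n}
    (h : t ∈ exchanges D) : exSwap t ∈ exchanges D := by
  rw [mem_exchanges] at *
  exact ⟨h.1.symm, h.2.2, h.2.1⟩

lemma exWt_swap (t : Finset (ZMod n) × ZMod n × ZMod n) : exWt (exSwap t) = -exWt t :=
  setWt_swap _ _

lemma sum_exchanges_swap (D : Finset (Finset (ZMod n)))
    (f : Finset (ZMod n) × ZMod n × ZMod n → ℤ) :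
    ∑ t ∈ exchanges D, exWt t * f (exSwap t) = -∑ t ∈ exchanges D, exWt t * f t := by
  rw [← sum_neg_distrib]
  refine sum_nbij' exSwap exSwap (fun t h => exSwap_mem h) (fun t h => exSwap_mem h)
    (fun _ _ => rfl) (fun _ _ => rfl) fun t _ => ?_
  rw [exWt_swap]
  ring

open scoped Classical in
lemma sum_consec_upSet (D : Finset (Finset (ZMod n))) :
    ∑ X, ∑ p ∈ consec (upSet D X), setWt (insert p.1 X) (insert p.2 X) =
      ∑ t ∈ exchanges D, exWt t * (1 - if HasUp D t then 1 else 0) := by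
  rw [← sum_finset_product (r := (exchanges D).filter fun t => ¬ HasUp D t) univ
    (fun X => consec (upSet D X)) ?_
    (f := fun t => setWt (insert t.2.1 t.1) (insert t.2.2 t.1)), sum_filter]
  · refine sum_congr rfl fun t _ => ?_
    rw [exWt]
    split_ifs <;> simp_all
  · intro t
    simp only [mem_filter, mem_exchanges, mem_univ, true_and, mem_consec, mem_upSet, HasUp,
      not_exists, not_and]
    tauto

open scoped Classical in
lemma sum_consec_downSet (D : Finset (Finset (ZMod n))) :
    ∑ Y, ∑ p ∈ consec (downSet D Y), setWt (Y.erase p.1) (Y.erase p.2) =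
      -∑ t ∈ exchanges D, exWt t * (1 - if HasDown D t then 1 else 0) := by
  have h1 : ∑ t ∈ exchanges D, exWt t * (1 - if HasDown D t then 1 else 0) =
      ∑ t ∈ (exchanges D).filter (fun t => ¬ HasDown D t), exWt t := by
    rw [sum_filter]
    refine sum_congr rfl fun t _ => ?_
    split_ifs <;> simp_all
  rw [h1, ← sum_neg_distrib, ← sum_finset_product
    (r := univ.filter fun t : Finset (ZMod n) × ZMod n × ZMod n => t.2 ∈ consec (downSet D t.1))
    univ (fun Y => consec (downSet D Y)) (by simp)
    (f := fun t => setWt (t.1.erase t.2.1) (t.1.erase t.2.2))]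
  refine sum_nbij' (fun t => ((t.1.erase t.2.1).erase t.2.2, t.2))
    (fun t => (insert t.2.2 (insert t.2.1 t.1), t.2)) ?_ ?_ ?_ ?_ ?_
  · rintro ⟨Y, a, b⟩ h
    simp only [mem_filter, mem_univ, true_and, mem_consec, mem_downSet] at h
    obtain ⟨⟨⟨aY, ha⟩, bY, hb⟩, hab, hc⟩ := h
    have e1 : insert b ((Y.erase a).erase b) = Y.erase a :=
      insert_erase (mem_erase.2 ⟨hab.symm, bY⟩)
    have e2 : insert a ((Y.erase a).erase b) = Y.erase b := by
      rw [erase_right_comm]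
      exact insert_erase (mem_erase.2 ⟨hab, aY⟩)
    refine mem_filter.2 ⟨mem_exchanges.2 ⟨hab, ⟨by simp, ?_⟩, by simp, ?_⟩, ?_⟩
    · simp only
      rw [e2]
      exact hb
    · simp only
      rw [e1]
      exact ha
    · rintro ⟨c, h1, h2⟩
      simp only at h1 h2
      rw [e2, insert_erase bY, mem_downSet] at h1
      exact hc c h1 h2
  · rintro ⟨X, a, b⟩ h
    simp only [mem_filter, mem_exchanges, HasDown, not_exists, not_and] at h
    obtain ⟨⟨hab, ⟨aX, ha⟩, bX, hb⟩, hc⟩ := h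
    refine mem_filter.2 ⟨mem_univ _, mem_consec.2 ⟨⟨mem_downSet.2 ⟨by simp, ?_⟩,
      mem_downSet.2 ⟨by simp, ?_⟩⟩, hab, hc⟩⟩
    · simp only
      rwa [insert_comm, erase_insert]
      simp [aX, hab]
    · simp only
      rwa [erase_insert]
      simp [bX, hab.symm]
  · rintro ⟨Y, a, b⟩ h
    simp only [mem_filter, mem_univ, true_and, mem_consec, mem_downSet] at h
    obtain ⟨⟨⟨aY, ha⟩, bY, hb⟩, hab, hc⟩ := h
    ext1
    · simp only
      rw [erase_right_comm, insert_erase (mem_erase.2 ⟨hab, aY⟩), insert_erase bY]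
    · rfl
  · rintro ⟨X, a, b⟩ h
    simp only [mem_filter, mem_exchanges] at h
    obtain ⟨⟨hab, ⟨aX, ha⟩, bX, hb⟩, -⟩ := h
    ext1
    · simp only
      rw [erase_right_comm, erase_insert (by simp [bX, hab.symm]), erase_insert aX]
    · rfl
  · rintro ⟨Y, a, b⟩ h
    simp only [mem_filter, mem_univ, true_and, mem_consec, mem_downSet] at h
    obtain ⟨⟨⟨aY, ha⟩, bY, hb⟩, hab, hc⟩ := h
    have e1 : insert b ((Y.erase a).erase b) = Y.erase a :=
      insert_erase (mem_erase.2 ⟨hab.symm, bY⟩)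
    have e2 : insert a ((Y.erase a).erase b) = Y.erase b := by
      rw [erase_right_comm]
      exact insert_erase (mem_erase.2 ⟨hab, aY⟩)
    simp only [exWt]
    rw [e1, e2, ← setWt_swap]

lemma sum_consec_upSet' (D : Finset (Finset (ZMod n))) :
    ∑ X, ∑ p ∈ consec (upSet D X), setWt (insert p.1 X) (insert p.2 X) =
      n * (2 * (#{X | 2 ≤ #(upSet D X)} : ℤ) - ∑ X, (#(consec (upSet D X)) : ℤ)) := by
  rw [card_filter, Nat.cast_sum, mul_sum, ← sum_sub_distrib, mul_sum]
  refine sum_congr rfl fun X _ => ?_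
  have := sum_consec_wt (upSet D X) fun b => ∑ i ∈ X, wt i b
  push_cast
  rw [← this]
  refine sum_congr rfl fun p hp => ?_
  obtain ⟨⟨h1, h2⟩, -⟩ := mem_consec.1 hp
  exact setWt_insert (mem_upSet.1 h1).1 (mem_upSet.1 h2).1

lemma sum_consec_downSet' (D : Finset (Finset (ZMod n))) :
    ∑ Y, ∑ p ∈ consec (downSet D Y), setWt (Y.erase p.1) (Y.erase p.2) =
      n * (2 * (#{Y | 2 ≤ #(downSet D Y)} : ℤ) - ∑ Y, (#(consec (downSet D Y)) : ℤ)) := by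
  rw [card_filter, Nat.cast_sum, mul_sum, ← sum_sub_distrib, mul_sum]
  refine sum_congr rfl fun Y _ => ?_
  have := sum_consec_wt (downSet D Y) fun b => -∑ i ∈ Y, wt i b
  push_cast
  rw [← this]
  refine sum_congr rfl fun p hp => ?_
  obtain ⟨⟨h1, h2⟩, -⟩ := mem_consec.1 hp
  rw [setWt_erase (mem_downSet.1 h1).1 (mem_downSet.1 h2).1]
  ring

namespace CycFam

variable {k m : ℕ} {D : Finset (Finset (ZMod n))}

open scoped Classical in
lemma trichotomy (hD : CycFam n k D) (hn : k + m = n) (h : #D = k * m + 1)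
    {t : Finset (ZMod n) × ZMod n × ZMod n} (ht : t ∈ exchanges D) :
    (if HasDown D t then (1 : ℤ) else 0) + (if HasUp D (exSwap t) then 1 else 0) +
      (if IsBdry t then 1 else 0) = 1 := by
  obtain ⟨X, a, b⟩ := t
  obtain ⟨hab, ⟨aX, ha⟩, bX, hb⟩ := mem_exchanges.1 ht
  simp only at hab aX ha bX hb
  have hdown : HasDown D (X, a, b) ↔
      ∃ c ∈ X, InArc a c b ∧ (insert b (insert a X)).erase c ∈ D := by
    constructor
    · rintro ⟨c, h1, h2⟩
      simp only [mem_downSet] at h1 h2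
      have hcb : c ≠ b := by
        rintro rfl
        exact lt_irrefl _ h2.2
      exact ⟨c, mem_of_mem_insert_of_ne (mem_of_mem_insert_of_ne h1.1 hcb) h2.1, h2, h1.2⟩
    · rintro ⟨c, h1, h2, h3⟩
      exact ⟨c, mem_downSet.2 ⟨by simp [h1], h3⟩, h2⟩
  have hup : HasUp D (exSwap (X, a, b)) ↔ ∃ c, c ∉ X ∧ InArc b c a ∧ insert c X ∈ D := by
    constructor
    · rintro ⟨c, h1, h2⟩
      exact ⟨c, (mem_upSet.1 h1).1, h2, (mem_upSet.1 h1).2⟩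
    · rintro ⟨c, h1, h2, h3⟩
      exact ⟨c, mem_upSet.2 ⟨h1, h3⟩, h2⟩
  have n1 : ¬ (HasDown D (X, a, b) ∧ HasUp D (exSwap (X, a, b))) := by
    rw [hdown, hup]
    rintro ⟨⟨c', h1, h2, h3⟩, c, h4, h5, h6⟩
    exact hD.not_both hab aX bX h4 h5 h6 h1 h2 h3
  have n2 : ¬ (IsBdry (X, a, b) ∧ HasUp D (exSwap (X, a, b))) := by
    rw [hup]
    rintro ⟨h1, c, h4, h5, h6⟩
    exact h4 ((h1 c).2 h5)
  have n3 : ¬ (IsBdry (X, a, b) ∧ HasDown D (X, a, b)) := by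
    rw [hdown]
    rintro ⟨h1, c, h2, h3, -⟩
    have h4 := (h1 c).1 h2
    have h5 := off_lt_of_inArc h3
    have h6 := off_lt_of_inArc h4
    obtain ⟨-, h4⟩ := h4
    obtain ⟨-, h3⟩ := h3
    have e1 := off_add_off a c b
    have e2 := off_add_off b c a
    have hac : a ≠ c := by rintro rfl; exact aX h2
    have hbc : b ≠ c := by rintro rfl; exact bX h2
    have e3 := off_add_off_swap hac
    have e4 := off_add_off_swap hbc
    have e5 := off_add_off_swap hab
    simp only at *
    omega
  have n4 : IsBdry (X, a, b) ∨ HasUp D (exSwap (X, a, b)) ∨ HasDown D (X, a, b) := by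
    rw [hdown, hup]
    exact hD.next hn h hab aX bX ha hb
  by_cases h1 : IsBdry (X, a, b) <;> by_cases h2 : HasUp D (exSwap (X, a, b)) <;>
    by_cases h3 : HasDown D (X, a, b) <;> simp_all

open scoped Classical in
lemma counting_bdry (hD : CycFam n k D) (hn : k + m = n) (h : #D = k * m + 1) :
    n * (2 * ((#{X | 2 ≤ #(upSet D X)} : ℤ) + #{Y | 2 ≤ #(downSet D Y)}) -
      (∑ X, (#(consec (upSet D X)) : ℤ) + ∑ Y, (#(consec (downSet D Y)) : ℤ))) =
    -∑ t ∈ (exchanges D).filter IsBdry, exWt t := by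
  have h1 := (sum_consec_upSet D).symm.trans (sum_consec_upSet' D)
  have h2 := (sum_consec_downSet D).symm.trans (sum_consec_downSet' D)
  have h3 := sum_exchanges_swap D fun t => if HasUp D t then 1 else 0
  have h4 := sum_exchanges_swap D fun _ => 1
  have h5 : ∑ t ∈ (exchanges D).filter IsBdry, exWt t =
      ∑ t ∈ exchanges D, exWt t * (1 - (if HasDown D t then (1 : ℤ) else 0) -
        (if HasUp D (exSwap t) then 1 else 0)) := by
    rw [sum_filter]
    refine sum_congr rfl fun t ht => ?_
    have h6 := hD.trichotomy hn h ht
    rw [show (1 : ℤ) - (if HasDown D t then (1 : ℤ) else 0) -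
      (if HasUp D (exSwap t) then 1 else 0) = if IsBdry t then 1 else 0 by linarith]
    split_ifs <;> ring
  simp only [mul_sub, mul_one, sum_sub_distrib] at h1 h2 h3 h4 h5
  rw [h5]
  linarith

end CycFam

end Identity

section Boundary

variable {n : ℕ} [NeZero n]

/-- The open arc from `b` to `a`. -/
def cycIoo (b a : ZMod n) : Finset (ZMod n) := univ.filter fun c => c ≠ b ∧ off b c < off b a

lemma mem_cycIoo {a b c : ZMod n} : c ∈ cycIoo b a ↔ InArc b c a := by
  simp [cycIoo, InArc]

lemma card_cycIoo (b a : ZMod n) : #(cycIoo b a) = off b a - 1 := by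
  rw [← card_map (offEmb b), show (cycIoo b a).map (offEmb b) = Ioo 0 (off b a) from ?_,
    Nat.card_Ioo]
  · omega
  · ext i
    rw [mem_Ioo]
    constructor
    · intro h
      obtain ⟨x, hx, rfl⟩ := exists_off_of_mem_map h
      obtain ⟨h1, h2⟩ := mem_cycIoo.1 hx
      exact ⟨Nat.pos_of_ne_zero fun h => h1 (off_eq_zero.1 h), h2⟩
    · rintro ⟨h1, h2⟩
      have hi : off b (b + (i : ℕ)) = i := off_add_natCast (h2.trans (off_lt _ _)) _
      rw [← hi, off_mem_map, mem_cycIoo]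
      refine ⟨fun h => ?_, by rwa [hi]⟩
      rw [h, off_self] at hi
      omega

namespace CycFam

variable {k m : ℕ} {D : Finset (Finset (ZMod n))}

lemma arc_mem (hD : CycFam n k D) (hn : k + m = n) (h : #D = k * m + 1) (b : ZMod n) {j : ℕ}
    (hj : j + k ≤ n) : (univ.filter fun c => j ≤ off b c ∧ off b c < j + k) ∈ D := by
  subst hn
  have hcard : #(_root_.unroll b D) = k * m + 1 := by rw [_root_.unroll, card_map, h]
  have h1 := (hD.unroll b).Ico_mem hcard (a := j) rfl hj
  rw [← map_mem_unroll (u := b)]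
  convert h1 using 1
  ext i
  rw [mem_Ico]
  constructor
  · intro h
    obtain ⟨x, hx, rfl⟩ := exists_off_of_mem_map h
    simpa using hx
  · rintro ⟨h1, h2⟩
    have hi : off b (b + (i : ℕ)) = i := off_add_natCast (by omega) _
    rw [← hi, off_mem_map]
    simp only [mem_filter, mem_univ, true_and]
    rw [hi]
    exact ⟨h1, h2⟩

open scoped Classical in
lemma bdry_mem (hD : CycFam n k D) (hn : k + m = n) (h : #D = k * m + 1) (hk : 1 ≤ k)
    (hm : 1 ≤ m) (b : ZMod n) :
    (cycIoo b (b + (k : ℕ)), b + (k : ℕ), b) ∈ (exchanges D).filter IsBdry := by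
  have hb : off b (b + (k : ℕ)) = k := off_add_natCast (by omega) _
  have e1 : insert (b + (k : ℕ)) (cycIoo b (b + (k : ℕ))) =
      univ.filter fun c => 1 ≤ off b c ∧ off b c < 1 + k := by
    ext c
    have h1 : c = b + (k : ℕ) ↔ off b c = k := by
      rw [← (off_injective b).eq_iff, hb]
    have h2 : c = b ↔ off b c = 0 := off_eq_zero.symm
    rw [mem_insert, mem_cycIoo, InArc, hb, ne_eq, h1, h2]
    simp only [mem_filter, mem_univ, true_and]
    omega
  have e2 : insert b (cycIoo b (b + (k : ℕ))) =
      univ.filter fun c => 0 ≤ off b c ∧ off b c < 0 + k := by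
    ext c
    have h2 : c = b ↔ off b c = 0 := off_eq_zero.symm
    rw [mem_insert, mem_cycIoo, InArc, hb, ne_eq, h2]
    simp only [mem_filter, mem_univ, true_and]
    omega
  refine mem_filter.2 ⟨mem_exchanges.2 ⟨?_, ⟨?_, ?_⟩, ?_, ?_⟩, fun c => mem_cycIoo⟩
  · simp only
    intro h
    rw [h, off_self] at hb
    omega
  · rw [mem_cycIoo]
    exact fun h => lt_irrefl _ h.2
  · simp only
    rw [e1]
    exact hD.arc_mem hn h b (by omega)
  · rw [mem_cycIoo]
    exact fun h => h.1 rfl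
  · simp only
    rw [e2]
    exact hD.arc_mem hn h b (by omega)

lemma exWt_bdry (hk : 1 ≤ k) (hkn : k < n) (b : ZMod n) :
    exWt (cycIoo b (b + (k : ℕ)), b + (k : ℕ), b) = (2 * k - 1) * n - 2 * k ^ 2 := by
  have hb : off b (b + (k : ℕ)) = k := off_add_natCast (by omega) _
  have hne : b + (k : ℕ) ≠ b := by
    intro h
    rw [h, off_self] at hb
    omega
  rw [exWt, setWt_insert, ← sum_sub_distrib]
  · have h1 : ∀ i ∈ cycIoo b (b + (k : ℕ)), wt i b - wt i (b + (k : ℕ)) = 2 * n - 2 * (k : ℤ) := by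
      intro i hi
      obtain ⟨h1, h2⟩ := mem_cycIoo.1 hi
      have h3 : i ≠ b + (k : ℕ) := by
        rintro rfl
        exact lt_irrefl _ h2
      rw [wt, wt, if_neg h1, if_neg h3]
      have e1 := off_add_off_swap h1
      have e2 := off_add_off b i (b + (k : ℕ))
      have := off_lt i (b + (k : ℕ))
      rw [hb] at *
      omega
    rw [sum_congr rfl h1, sum_const, card_cycIoo, hb, wt_swap b, wt, if_neg hne.symm, hb,
      nsmul_eq_mul, Nat.cast_sub hk]
    push_cast
    ring
  · rw [mem_cycIoo]
    exact fun h => lt_irrefl _ h.2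
  · rw [mem_cycIoo]
    exact fun h => h.1 rfl

/-- The counting identity for non-crossing families of maximal size. -/
theorem counting (hD : CycFam n k D) (hn : k + m = n) (h : #D = k * m + 1) (hk : 1 ≤ k)
    (hm : 1 ≤ m) :
    2 * ((#{X | 2 ≤ #(upSet D X)} : ℤ) + #{Y | 2 ≤ #(downSet D Y)}) -
      (∑ X, (#(consec (upSet D X)) : ℤ) + ∑ Y, (#(consec (downSet D Y)) : ℤ)) =
    2 * k ^ 2 - (2 * k - 1) * n := by
  classical
  have hn0 : (n : ℤ) ≠ 0 := by exact_mod_cast NeZero.ne n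
  have key : ∑ t ∈ (exchanges D).filter IsBdry, exWt t =
      ∑ b : ZMod n, exWt (cycIoo b (b + (k : ℕ)), b + (k : ℕ), b) := by
    refine sum_nbij' (fun t => t.2.2) (fun b => (cycIoo b (b + (k : ℕ)), b + (k : ℕ), b))
      (fun _ _ => mem_univ _) (fun b _ => hD.bdry_mem hn h hk hm b) ?_ (fun _ _ => rfl) ?_
    all_goals
      rintro ⟨X, a, b⟩ ht
      obtain ⟨ht, hX⟩ := mem_filter.1 ht
      obtain ⟨hab, ⟨aX, ha⟩, bX, hb⟩ := mem_exchanges.1 ht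
      have hX : X = cycIoo b a := by
        ext c
        rw [mem_cycIoo]
        exact hX c
      have hc := hD.card_mem _ hb
      simp only at hc bX
      rw [card_insert_of_notMem bX, hX, card_cycIoo] at hc
      have h0 : off b a ≠ 0 := fun h => hab (off_eq_zero.1 h)
      have hba : b + (k : ℕ) = a := by
        apply off_injective b
        rw [off_add_natCast (by omega)]
        omega
      simp only [hba, hX]
  apply mul_left_cancel₀ hn0
  rw [hD.counting_bdry hn h, key, sum_congr rfl fun b _ => exWt_bdry hk (by omega) b, sum_const,
    card_univ, ZMod.card, nsmul_eq_mul]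
  ring

end CycFam

end Boundary

/-- If the returns of a self-map of a finite set to each point are all divisible by `d` after
multiplication by `c`, then so is the size of the set. -/
lemma dvd_mul_card_of_iterate {α : Type*} [DecidableEq α] {f : α → α} {c d : ℕ} (hd : 0 < d) :
    ∀ s : Finset α, (∀ x ∈ s, f x ∈ s) → (∀ x ∈ s, f^[d] x = x) →
      (∀ x ∈ s, ∀ j, f^[j] x = x → d ∣ c * j) → d ∣ c * #s := by
  intro s
  induction s using Finset.strongInduction with
  | H s ih =>
    intro h1 h2 h3
    rcases s.eq_empty_or_nonempty with rfl | ⟨x, hx⟩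
    · simp
    set p := Function.minimalPeriod f x with hp
    have hper : Function.IsPeriodicPt f d x := h2 x hx
    have hp0 : 0 < p := hper.minimalPeriod_pos hd
    have hfp : f^[p] x = x := Function.iterate_minimalPeriod
    set O := (range p).image fun i => f^[i] x with hO
    have hiter : ∀ i, f^[i] x ∈ s := by
      intro i
      induction i with
      | zero => exact hx
      | succ i ih => rw [Function.iterate_succ_apply']; exact h1 _ ih
    have hOs : O ⊆ s := by
      intro y hy
      obtain ⟨i, -, rfl⟩ := mem_image.1 hy
      exact hiter i
    have hOmem : ∀ i, f^[i] x ∈ O := fun i =>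
      mem_image.2 ⟨i % p, mem_range.2 (Nat.mod_lt _ hp0), Function.iterate_mod_minimalPeriod_eq⟩
    have hcard : #O = p := by
      rw [hO, card_image_of_injOn, card_range]
      intro i hi j hj hij
      exact Function.iterate_injOn_Iio_minimalPeriod (by simpa using hi) (by simpa using hj) hij
    have hlt : s \ O ⊂ s := by
      refine Finset.ssubset_iff_subset_ne.2 ⟨sdiff_subset, fun h => ?_⟩
      have : x ∈ s \ O := by rw [h]; exact hx
      exact (mem_sdiff.1 this).2 (hOmem 0)
    have ih' := ih (s \ O) hlt ?_ (fun y hy => h2 y (mem_sdiff.1 hy).1)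
      (fun y hy => h3 y (mem_sdiff.1 hy).1)
    · have e : #s = #(s \ O) + p := by rw [← hcard, card_sdiff_add_card_eq_card hOs]
      rw [e, mul_add]
      exact dvd_add ih' (h3 x hx p hfp)
    · intro y hy
      obtain ⟨hys, hyO⟩ := mem_sdiff.1 hy
      refine mem_sdiff.2 ⟨h1 y hys, fun h => hyO ?_⟩
      obtain ⟨i, -, hi⟩ := mem_image.1 h
      have : y = f^[d - 1 + i] x := by
        rw [Function.iterate_add_apply, hi, ← Function.iterate_succ_apply,
          Nat.succ_eq_add_one, Nat.sub_add_cancel hd, h2 y hys]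
      rw [this]
      exact hOmem _

section Rotation

variable {n : ℕ}

/-- The translate `I + t`. -/
def rot (t : ZMod n) (I : Finset (ZMod n)) : Finset (ZMod n) :=
  I.map (Equiv.addRight t).toEmbedding

lemma mem_rot {t x : ZMod n} {I : Finset (ZMod n)} : x ∈ rot t I ↔ x - t ∈ I := by
  rw [rot, mem_map_equiv, Equiv.addRight_symm, Equiv.coe_addRight, sub_eq_add_neg]

lemma card_rot (t : ZMod n) (I : Finset (ZMod n)) : #(rot t I) = #I := card_map _

lemma rot_rot (s t : ZMod n) (I : Finset (ZMod n)) : rot t (rot s I) = rot (s + t) I := by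
  ext x
  rw [mem_rot, mem_rot, mem_rot, sub_sub, add_comm]

lemma rot_zero (I : Finset (ZMod n)) : rot 0 I = I := by
  ext x
  rw [mem_rot, sub_zero]

lemma rot_iterate (t : ZMod n) (j : ℕ) (I : Finset (ZMod n)) : (rot t)^[j] I = rot (j • t) I := by
  induction j with
  | zero => simp [rot_zero]
  | succ j ih => rw [Function.iterate_succ_apply', ih, rot_rot, succ_nsmul]

lemma rot_insert (t a : ZMod n) (I : Finset (ZMod n)) :
    rot t (insert a I) = insert (a + t) (rot t I) := by
  ext x
  simp only [mem_rot, mem_insert, sub_eq_iff_eq_add]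

lemma rot_erase (t a : ZMod n) (I : Finset (ZMod n)) :
    rot t (I.erase a) = (rot t I).erase (a + t) := by
  ext x
  simp only [mem_rot, mem_erase, ne_eq, sub_eq_iff_eq_add]

lemma rot_eq_self_nsmul {t : ZMod n} {I : Finset (ZMod n)} (h : rot t I = I) (j : ℕ) :
    rot (j • t) I = I := by
  rw [← rot_iterate]
  exact Function.iterate_fixed h j

lemma mem_add_of_rot_eq {t x : ZMod n} {I : Finset (ZMod n)} (h : rot t I = I) :
    x + t ∈ I ↔ x ∈ I := by
  conv_lhs => rw [← h, mem_rot, add_sub_cancel_right]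

/-- The family `D` is closed under translation by `t`. -/
def RotClosed (t : ZMod n) (D : Finset (Finset (ZMod n))) : Prop := ∀ I ∈ D, rot t I ∈ D

lemma RotClosed.nsmul {t : ZMod n} {D : Finset (Finset (ZMod n))} (h : RotClosed t D) (j : ℕ) :
    RotClosed (j • t) D := by
  intro I hI
  induction j with
  | zero => rwa [zero_nsmul, rot_zero]
  | succ j ih => rw [succ_nsmul, ← rot_rot]; exact h _ ih

variable [NeZero n]

lemma RotClosed.mem_iff {t : ZMod n} {D : Finset (Finset (ZMod n))} (h : RotClosed t D)
    {I : Finset (ZMod n)} : rot t I ∈ D ↔ I ∈ D := by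
  refine ⟨fun hI => ?_, h I⟩
  have h1 := h.nsmul (n - 1) _ hI
  have h2 : t + (n - 1) • t = 0 := by
    rw [← succ_nsmul', Nat.sub_add_cancel (Nat.one_le_iff_ne_zero.2 (NeZero.ne n)),
      nsmul_eq_mul]
    simp
  rwa [rot_rot, h2, rot_zero] at h1

lemma upSet_rot {t : ZMod n} {D : Finset (Finset (ZMod n))} (h : RotClosed t D)
    (X : Finset (ZMod n)) : upSet D (rot t X) = rot t (upSet D X) := by
  ext a
  rw [mem_rot, mem_upSet, mem_upSet, ← h.mem_iff (I := insert (a - t) X), rot_insert,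
    sub_add_cancel, mem_rot]

lemma downSet_rot {t : ZMod n} {D : Finset (Finset (ZMod n))} (h : RotClosed t D)
    (Y : Finset (ZMod n)) : downSet D (rot t Y) = rot t (downSet D Y) := by
  ext a
  rw [mem_rot, mem_downSet, mem_downSet, ← h.mem_iff (I := Y.erase (a - t)), rot_erase,
    sub_add_cancel, mem_rot]

lemma mem_consec_rot {t a b : ZMod n} {A : Finset (ZMod n)} :
    (a + t, b + t) ∈ consec (rot t A) ↔ (a, b) ∈ consec A := by
  simp only [mem_consec, mem_rot, add_sub_cancel_right, ne_eq, add_left_inj]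
  refine and_congr Iff.rfl (and_congr Iff.rfl ⟨fun h c hc hcon => ?_, fun h c hc hcon => ?_⟩)
  · refine h (c + t) (by rwa [add_sub_cancel_right]) ?_
    simpa [InArc, off_add_add] using hcon
  · apply h (c - t) hc
    obtain ⟨c, rfl⟩ : ∃ c', c = c' + t := ⟨c - t, by ring⟩
    simpa [InArc, off_add_add] using hcon

lemma dvd_of_rot_eq {g : ZMod n} {I : Finset (ZMod n)} (h : rot g I = I) :
    addOrderOf g ∣ #I := by
  rw [← one_mul #I]
  refine dvd_mul_card_of_iterate (f := fun x => x + g) (addOrderOf_pos g) I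
    (fun x hx => (mem_add_of_rot_eq h).2 hx) (fun x _ => ?_) (fun x _ j hj => ?_)
  · simp only [add_right_iterate, addOrderOf_nsmul_eq_zero, add_zero]
  · simp only [add_right_iterate, add_eq_left] at hj
    rw [one_mul]
    exact addOrderOf_dvd_of_nsmul_eq_zero hj

/-- A nonzero period of a set gives a period dividing `n`. -/
lemma exists_dvd_period {t : ZMod n} (ht : t ≠ 0) : ∃ τ j m : ℕ, 0 < τ ∧ n = τ * m ∧ 2 ≤ m ∧
    (τ : ZMod n) = j • t ∧ (m = 2 → 2 • t = 0) := by
  have hv : t.val ≠ 0 := fun h => ht ((ZMod.val_eq_zero t).1 h)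
  have hlt := ZMod.val_lt t
  have hg : Nat.gcd t.val n < n := (Nat.gcd_le_left n (Nat.pos_of_ne_zero hv)).trans_lt hlt
  obtain ⟨j, -, hj⟩ := Nat.exists_mul_mod_eq_gcd hg
  obtain ⟨m, hm⟩ := Nat.gcd_dvd_right t.val n
  have hpos : 0 < Nat.gcd t.val n := Nat.gcd_pos_of_pos_left _ (Nat.pos_of_ne_zero hv)
  refine ⟨Nat.gcd t.val n, j, m, hpos, hm, ?_, ?_, ?_⟩
  · by_contra hcon
    interval_cases m <;> omega
  · rw [← hj, ZMod.natCast_mod]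
    push_cast
    rw [ZMod.natCast_zmod_val, nsmul_eq_mul, mul_comm]
  · rintro rfl
    obtain ⟨i, hi⟩ := Nat.gcd_dvd_left t.val n
    have : ((2 * t.val : ℕ) : ZMod n) = 0 := by
      rw [ZMod.natCast_eq_zero_iff]
      refine ⟨i, ?_⟩
      conv_lhs => rw [hi]
      conv_rhs => rw [hm]
      ring
    rw [nsmul_eq_mul]
    simpa using this

/-- Two distinct sets of equal size with a common period have alternating points within one
period. -/
lemma exists_close_pair {τ : ℕ} (hτ0 : 0 < τ) {X X' : Finset (ZMod n)} (hc : #X = #X')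
    (hne : X ≠ X')
    (hX : rot (τ : ZMod n) X = X) (hX' : rot (τ : ZMod n) X' = X') :
    ∃ p q, (p ∈ X ∧ p ∉ X') ∧ (q ∈ X' ∧ q ∉ X) ∧ off p q < τ := by
  obtain ⟨p, hp⟩ : (X \ X').Nonempty := by
    rw [sdiff_nonempty]
    exact fun hs => hne (eq_of_subset_of_card_le hs hc.ge)
  obtain ⟨q₀, hq₀⟩ : (X' \ X).Nonempty := by
    rw [sdiff_nonempty]
    exact fun hs => hne (eq_of_subset_of_card_le hs hc.le).symm
  obtain ⟨q, hq, hmin⟩ := exists_min_image (X' \ X) (off p) ⟨q₀, hq₀⟩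
  rw [mem_sdiff] at hp hq
  refine ⟨p, q, hp, hq, ?_⟩
  by_contra hcon
  have hlt := off_lt p q
  have hmem : q - (τ : ZMod n) ∈ X' \ X := by
    rw [mem_sdiff, ← mem_add_of_rot_eq hX, ← mem_add_of_rot_eq hX', sub_add_cancel]
    exact hq
  have h1 := hmin _ hmem
  have h2 := off_add_off p (q - (τ : ZMod n)) q
  have h3 : off (q - (τ : ZMod n)) q = τ := by
    have : q = q - (τ : ZMod n) + (τ : ZMod n) := by ring
    conv_lhs => rw [this]
    rw [add_sub_cancel_right]
    exact off_add_natCast (by omega) _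
  have h4 := off_lt p (q - (τ : ZMod n))
  omega

lemma crossing_of_close {τ : ℕ} (hτ0 : 0 < τ) (hτn : 2 * τ ≤ n) {p q : ZMod n} (hpq : off p q < τ)
    {I J : Finset (ZMod n)} (h1 : p ∈ I ∧ p ∉ J) (h2 : q ∈ J ∧ q ∉ I)
    (h3 : p + (τ : ZMod n) ∈ I ∧ p + (τ : ZMod n) ∉ J)
    (h4 : q + (τ : ZMod n) ∈ J ∧ q + (τ : ZMod n) ∉ I) :
    Crossing I J := by
  have e1 : off p (p + (τ : ZMod n)) = τ := off_add_natCast (by omega) _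
  have e2 : off q (q + (τ : ZMod n)) = τ := off_add_natCast (by omega) _
  have e3 := off_add_off p q (q + (τ : ZMod n))
  have := off_lt p (q + (τ : ZMod n))
  have : off p q ≠ 0 := fun h => h1.2 (off_eq_zero.1 h ▸ h2.1)
  exact ⟨p, q, p + (τ : ZMod n), q + (τ : ZMod n), h1, h2, h3, h4, by omega, by omega⟩

end Rotation

section Necessity

variable {n : ℕ}

lemma exists_mem_avoid {τ : ℕ} (hτ0 : 0 < τ) (hτn : 3 * τ ≤ n) {A : Finset (ZMod n)}
    (hA : rot (τ : ZMod n) A = A) (hne : A.Nonempty) (x y : ZMod n) :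
    ∃ a ∈ A, a ≠ x ∧ a ≠ y := by
  obtain ⟨a, ha⟩ := hne
  have h1 := (mem_add_of_rot_eq hA).2 ha
  have h2 := (mem_add_of_rot_eq hA).2 h1
  have e0 := off_self a
  have e1 : off a (a + (τ : ZMod n)) = τ := off_add_natCast (by omega) _
  have e2 : off a (a + τ + (τ : ZMod n)) = 2 * τ := by
    have : a + τ + (τ : ZMod n) = a + ((2 * τ : ℕ) : ZMod n) := by push_cast; ring
    rw [this, off_add_natCast (by omega)]
  by_contra! hcon
  have c0 := hcon _ ha
  have c1 := hcon _ h1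
  have c2 := hcon _ h2
  have n1 : a + (τ : ZMod n) ≠ a := fun h => by rw [h] at e1; omega
  have n2 : a + τ + (τ : ZMod n) ≠ a := fun h => by rw [h] at e2; omega
  have n3 : a + τ + (τ : ZMod n) ≠ a + τ := fun h => by rw [h] at e2; omega
  have d0 := (eq_or_ne a x).imp_right c0
  have d1 := (eq_or_ne (a + (τ : ZMod n)) x).imp_right c1
  have d2 := (eq_or_ne (a + τ + (τ : ZMod n)) x).imp_right c2
  clear hcon c0 c1 c2
  generalize a + τ + (τ : ZMod n) = a₂ at *
  generalize a + (τ : ZMod n) = a₁ at *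
  grind

variable [NeZero n]

lemma dvd_sum_card_consec {g : ZMod n} {F : Finset (ZMod n) → Finset (ZMod n)}
    (hF : ∀ X, F (rot g X) = rot g (F X)) : addOrderOf g ∣ ∑ X, #(consec (F X)) := by
  rw [← card_sigma, ← one_mul (#_)]
  let f : (_ : Finset (ZMod n)) × ZMod n × ZMod n → (_ : Finset (ZMod n)) × ZMod n × ZMod n :=
    fun p => ⟨rot g p.1, p.2.1 + g, p.2.2 + g⟩
  have hf : ∀ j p, f^[j] p = ⟨rot (j • g) p.1, p.2.1 + j • g, p.2.2 + j • g⟩ := by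
    intro j p
    induction j with
    | zero => simp [rot_zero]
    | succ j ih =>
      rw [Function.iterate_succ_apply', ih]
      simp only [f, rot_rot, succ_nsmul, add_assoc]
  refine dvd_mul_card_of_iterate (f := f) (addOrderOf_pos g) _ ?_ ?_ ?_
  · rintro ⟨X, a, b⟩ h
    simp only [mem_sigma, mem_univ, true_and, f] at h ⊢
    rw [hF]
    exact mem_consec_rot.2 h
  · rintro ⟨X, a, b⟩ -
    simp only [hf, addOrderOf_nsmul_eq_zero, rot_zero, add_zero]
  · rintro ⟨X, a, b⟩ - j h
    rw [hf] at h
    simp only [Sigma.mk.injEq, heq_eq_eq, Prod.mk.injEq, add_eq_left] at h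
    rw [one_mul]
    exact addOrderOf_dvd_of_nsmul_eq_zero h.2.1

lemma dvd_two_mul_card_filter {g : ZMod n} {F : Finset (ZMod n) → Finset (ZMod n)}
    (hF : ∀ X, F (rot g X) = rot g (F X))
    (h : ∀ X, (F X).Nonempty → ∀ j : ℕ, rot (j • g) X = X → 2 • j • g = 0) :
    addOrderOf g ∣ 2 * #{X | 2 ≤ #(F X)} := by
  refine dvd_mul_card_of_iterate (f := rot g) (addOrderOf_pos g) _ ?_ ?_ ?_
  · intro X hX
    simp only [mem_filter, mem_univ, true_and] at hX ⊢
    rwa [hF, card_rot]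
  · intro X _
    rw [rot_iterate, addOrderOf_nsmul_eq_zero, rot_zero]
  · intro X hX j hj
    rw [rot_iterate] at hj
    simp only [mem_filter, mem_univ, true_and] at hX
    refine addOrderOf_dvd_of_nsmul_eq_zero ?_
    rw [mul_nsmul']
    exact h X (card_pos.1 (by omega)) j hj

namespace CycFam

variable {k m : ℕ} {D : Finset (Finset (ZMod n))} {g t : ZMod n}

lemma eq_zero_of_rot_eq (hD : CycFam n k D) (hg : RotClosed g D) (hdk : ¬ addOrderOf g ∣ k)
    {I : Finset (ZMod n)} (hI : I ∈ D) (ht : rot t I = I) : t = 0 := by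
  by_contra ht0
  obtain ⟨τ, j, m, hτ0, hn, hm, hτ, -⟩ := exists_dvd_period ht0
  have hτI : rot (τ : ZMod n) I = I := by rw [hτ]; exact rot_eq_self_nsmul ht j
  have hτJ : rot (τ : ZMod n) (rot g I) = rot g I := by rw [rot_rot, add_comm, ← rot_rot, hτI]
  have hne : I ≠ rot g I := fun h => hdk (hD.card_mem I hI ▸ dvd_of_rot_eq h.symm)
  obtain ⟨p, q, hp, hq, hpq⟩ := exists_close_pair hτ0 (card_rot g I).symm hne hτI hτJ
  refine hD.noncross I hI _ (hg I hI) (crossing_of_close hτ0 (by nlinarith) hpq hp hq ?_ ?_)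
  · rwa [mem_add_of_rot_eq hτI, mem_add_of_rot_eq hτJ]
  · rwa [mem_add_of_rot_eq hτI, mem_add_of_rot_eq hτJ]

lemma addOrderOf_dvd_card (hD : CycFam n k D) (hg : RotClosed g D)
    (hdk : ¬ addOrderOf g ∣ k) : addOrderOf g ∣ #D := by
  rw [← one_mul #D]
  refine dvd_mul_card_of_iterate (f := rot g) (addOrderOf_pos g) D hg (fun I _ => ?_)
    (fun I hI j hj => ?_)
  · rw [rot_iterate, addOrderOf_nsmul_eq_zero, rot_zero]
  · rw [rot_iterate] at hj
    rw [one_mul]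
    exact addOrderOf_dvd_of_nsmul_eq_zero (hD.eq_zero_of_rot_eq hg hdk hI hj)

lemma card_add_one_of_mem_upSet (hD : CycFam n k D) {X : Finset (ZMod n)} {a : ZMod n}
    (ha : a ∈ upSet D X) : #X + 1 = k := by
  rw [mem_upSet] at ha
  rw [← card_insert_of_notMem ha.1, hD.card_mem _ ha.2]

lemma card_of_mem_downSet (hD : CycFam n k D) {Y : Finset (ZMod n)} {a : ZMod n}
    (ha : a ∈ downSet D Y) : #Y = k + 1 := by
  rw [mem_downSet] at ha
  rw [← card_erase_add_one ha.1, hD.card_mem _ ha.2]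

lemma two_nsmul_of_upSet (hD : CycFam n k D) (hg : RotClosed g D) (ht : RotClosed t D)
    {X : Finset (ZMod n)} (hX : ¬ addOrderOf g ∣ #X) (hne : (upSet D X).Nonempty)
    (htX : rot t X = X) : 2 • t = 0 := by
  by_contra ht0
  obtain ⟨τ, j, m, hτ0, hn, hm, hτ, hm2⟩ :=
    exists_dvd_period (t := t) (fun h => ht0 (by rw [h, nsmul_zero]))
  have hm3 : 3 ≤ m := (Nat.lt_of_le_of_ne hm fun h => ht0 (hm2 h.symm))
  have hτn : 3 * τ ≤ n := by nlinarith
  have hτX : rot (τ : ZMod n) X = X := by rw [hτ]; exact rot_eq_self_nsmul htX j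
  have hτX' : rot (τ : ZMod n) (rot g X) = rot g X := by
    rw [rot_rot, add_comm, ← rot_rot, hτX]
  have hτD : RotClosed (τ : ZMod n) D := by rw [hτ]; exact ht.nsmul j
  have hXX' : X ≠ rot g X := fun h => hX (dvd_of_rot_eq h.symm)
  obtain ⟨p, q, hp, hq, hpq⟩ := exists_close_pair hτ0 (card_rot g X).symm hXX' hτX hτX'
  obtain ⟨a, ha, haq, haq'⟩ := exists_mem_avoid hτ0 hτn (A := upSet D X)
    (by rw [← upSet_rot hτD, hτX]) hne (q + τ) (q + τ + τ)
  obtain ⟨b, hb, hbp, hbp'⟩ := exists_mem_avoid hτ0 hτn (A := upSet D (rot g X))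
    (by rw [← upSet_rot hτD, hτX']) (by rw [upSet_rot hg]; exact hne.map) (p + τ) (p + τ + τ)
  rw [mem_upSet] at ha hb
  refine hD.noncross _ ha.2 _ hb.2 (crossing_of_close (p := p + (τ : ZMod n))
    (q := q + (τ : ZMod n)) hτ0 (by omega) (by rwa [off_add_add]) ?_ ?_ ?_ ?_) <;>
  simp only [mem_insert, mem_add_of_rot_eq hτX, mem_add_of_rot_eq hτX', hp, hq, or_true, or_false,
    true_and, haq.symm, haq'.symm, hbp.symm, hbp'.symm, not_false_eq_true]

lemma two_nsmul_of_downSet (hD : CycFam n k D) (hg : RotClosed g D) (ht : RotClosed t D)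
    {Y : Finset (ZMod n)} (hY : ¬ addOrderOf g ∣ #Y) (hne : (downSet D Y).Nonempty)
    (htY : rot t Y = Y) : 2 • t = 0 := by
  by_contra ht0
  obtain ⟨τ, j, m, hτ0, hn, hm, hτ, hm2⟩ :=
    exists_dvd_period (t := t) (fun h => ht0 (by rw [h, nsmul_zero]))
  have hm3 : 3 ≤ m := (Nat.lt_of_le_of_ne hm fun h => ht0 (hm2 h.symm))
  have hτn : 3 * τ ≤ n := by nlinarith
  have hτY : rot (τ : ZMod n) Y = Y := by rw [hτ]; exact rot_eq_self_nsmul htY j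
  have hτY' : rot (τ : ZMod n) (rot g Y) = rot g Y := by
    rw [rot_rot, add_comm, ← rot_rot, hτY]
  have hτD : RotClosed (τ : ZMod n) D := by rw [hτ]; exact ht.nsmul j
  have hYY' : Y ≠ rot g Y := fun h => hY (dvd_of_rot_eq h.symm)
  obtain ⟨p, q, hp, hq, hpq⟩ := exists_close_pair hτ0 (card_rot g Y).symm hYY' hτY hτY'
  obtain ⟨a, ha, hap, hap'⟩ := exists_mem_avoid hτ0 hτn (A := downSet D Y)
    (by rw [← downSet_rot hτD, hτY]) hne (p + τ) (p + τ + τ)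
  obtain ⟨b, hb, hbq, hbq'⟩ := exists_mem_avoid hτ0 hτn (A := downSet D (rot g Y))
    (by rw [← downSet_rot hτD, hτY']) (by rw [downSet_rot hg]; exact hne.map) (q + τ) (q + τ + τ)
  rw [mem_downSet] at ha hb
  refine hD.noncross _ ha.2 _ hb.2 (crossing_of_close (p := p + (τ : ZMod n))
    (q := q + (τ : ZMod n)) hτ0 (by omega) (by rwa [off_add_add]) ?_ ?_ ?_ ?_) <;>
  simp only [mem_erase, mem_add_of_rot_eq hτY, mem_add_of_rot_eq hτY', hp, hq, and_true, and_false,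
    hap.symm, hap'.symm, hbq.symm, hbq'.symm, not_false_eq_true, ne_eq]

/-- A full-size rotation-symmetric family forces `k` to be `0`, `1` or `-1` modulo the order of
the rotation. -/
theorem addOrderOf_dvd_of_rotClosed (hD : CycFam n k D) (hg : RotClosed g D) (hn : k + m = n)
    (hk : 1 ≤ k) (hm : 1 ≤ m) (h : #D = k * m + 1) :
    addOrderOf g ∣ k ∨ addOrderOf g ∣ k - 1 ∨ addOrderOf g ∣ k + 1 := by
  by_contra! hcon
  obtain ⟨h0, h1, h2⟩ := hcon
  have hcount := hD.counting hn h hk hm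
  have c1 := h ▸ hD.addOrderOf_dvd_card hg h0
  have c2 := dvd_sum_card_consec (upSet_rot hg)
  have c3 := dvd_sum_card_consec (downSet_rot hg)
  have c4 : addOrderOf g ∣ 2 * #{X | 2 ≤ #(upSet D X)} := by
    refine dvd_two_mul_card_filter (upSet_rot hg) fun X hX j hj => ?_
    obtain ⟨a, ha⟩ := hX
    refine hD.two_nsmul_of_upSet hg (hg.nsmul j) ?_ ⟨a, ha⟩ hj
    rwa [Nat.eq_sub_of_add_eq (hD.card_add_one_of_mem_upSet ha)]
  have c5 : addOrderOf g ∣ 2 * #{X | 2 ≤ #(downSet D X)} := by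
    refine dvd_two_mul_card_filter (downSet_rot hg) fun X hX j hj => ?_
    obtain ⟨a, ha⟩ := hX
    refine hD.two_nsmul_of_downSet hg (hg.nsmul j) ?_ ⟨a, ha⟩ hj
    rwa [hD.card_of_mem_downSet ha]
  have c6 : addOrderOf g ∣ n := by
    have := _root_.addOrderOf_dvd_card (x := g)
    rwa [ZMod.card] at this
  set d := addOrderOf g
  rw [← Int.natCast_dvd_natCast] at c1 c2 c3 c4 c5 c6
  push_cast at c1 c2 c3 c4 c5 c6
  zify at hn
  have e1 : (d : ℤ) ∣ 2 * (k : ℤ) ^ 2 - (2 * k - 1) * n := by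
    rw [← hcount, mul_add]
    exact dvd_sub (dvd_add c4 c5) (dvd_add c2 c3)
  have e2 : (d : ℤ) ∣ 2 := by
    have h3 := dvd_add (dvd_mul_of_dvd_right c1 2)
      (dvd_add e1 (dvd_mul_of_dvd_right c6 (-1 : ℤ)))
    rw [← hn] at h3
    ring_nf at h3
    exact h3
  have e3 : d ∣ 2 := by exact_mod_cast e2
  obtain hd | hd := (Nat.dvd_prime Nat.prime_two).1 e3
  · exact h0 (hd ▸ one_dvd k)
  · rw [hd] at h0 h1
    omega

end CycFam

end Necessity

lemma card_filter_card_le {α : Type*} [DecidableEq α] (φ : α → ℕ) (k : ℕ) (R : Finset α)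
    (hφ : Set.InjOn φ R) : k ≤ #R → k ≤ #{u ∈ R | #{x ∈ R | φ x ≤ φ u} ≤ k} := by
  induction R using Finset.induction_on_max_value φ with
  | empty => intro h; simpa using h
  | insert a s ha hmax ih =>
    intro hk
    rw [card_insert_of_notMem ha] at hk
    rcases Nat.lt_or_ge #s k with h | h
    · refine (hk.trans_eq (card_insert_of_notMem ha).symm).trans
        (card_le_card fun u hu => mem_filter.2 ⟨hu, ?_⟩)
      refine (card_filter_le _ _).trans ?_
      rw [card_insert_of_notMem ha]
      omega
    · refine (ih (hφ.mono (by simp)) h).trans (card_le_card fun u hu => ?_)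
      obtain ⟨hus, hu⟩ := mem_filter.1 hu
      refine mem_filter.2 ⟨mem_insert_of_mem hus, ?_⟩
      have hne : φ u ≠ φ a := fun h => ha (hφ (by simp [hus]) (by simp) h ▸ hus)
      have hlt := lt_of_le_of_ne (hmax u hus) hne
      rwa [filter_insert, if_neg (by omega)]

lemma exists_eq_of_step {f : ℕ → ℕ} (hf : ∀ i, f (i + 1) ≤ f i + 1) {a b k : ℕ} (hab : a ≤ b)
    (ha : f a ≤ k) (hb : k ≤ f b) : ∃ c, a ≤ c ∧ c ≤ b ∧ f c = k := by
  induction b, hab using Nat.le_induction with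
  | base => exact ⟨a, le_rfl, le_rfl, by omega⟩
  | succ b hab ih =>
    rcases Nat.lt_or_ge (f b) k with h | h
    · have := hf b
      exact ⟨b + 1, by omega, le_rfl, by omega⟩
    · obtain ⟨c, h1, h2, h3⟩ := ih h
      exact ⟨c, h1, by omega, h3⟩

section Sufficiency

variable {n : ℕ}

/-- The points of `R` at clockwise distance less than `A` (if in `S`) or `B` (if not in `S`)
from `u`. -/
def twoArc (R S : Finset (ZMod n)) (u : ZMod n) (A B : ℕ) : Finset (ZMod n) :=
  {x ∈ R | off u x < if x ∈ S then A else B}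

lemma mem_twoArc {R S : Finset (ZMod n)} {u x : ZMod n} {A B : ℕ} :
    x ∈ twoArc R S u A B ↔ x ∈ R ∧ off u x < if x ∈ S then A else B := mem_filter

lemma rot_twoArc {R S : Finset (ZMod n)} {g : ZMod n} (hR : rot g R = R) (hS : rot g S = S)
    (u : ZMod n) (A B : ℕ) : rot g (twoArc R S u A B) = twoArc R S (u + g) A B := by
  ext x
  obtain ⟨x, rfl⟩ : ∃ y, x = y + g := ⟨x - g, by ring⟩
  rw [mem_rot, add_sub_cancel_right, mem_twoArc, mem_twoArc, mem_add_of_rot_eq hR, off_add_add]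
  simp only [mem_add_of_rot_eq hS]

lemma twoArc_alternation {n e A B A' B' x₁ x₂ x₃ x₄ y₁ y₂ y₃ y₄ h₁ h₂ h₃ h₄ h₁' h₂' h₃' h₄' : ℕ}
    (hA : A ≤ B) (hA' : A' ≤ B') (h12 : x₁ < x₂) (h23 : x₂ < x₃) (h34 : x₃ < x₄) (hx : x₄ < n)
    (l2 : y₂ < n) (l3 : y₃ < n) (l4 : y₄ < n)
    (e1 : e + y₁ = x₁ ∨ e + y₁ = x₁ + n) (e2 : e + y₂ = x₂ ∨ e + y₂ = x₂ + n)
    (e3 : e + y₃ = x₃ ∨ e + y₃ = x₃ + n) (e4 : e + y₄ = x₄ ∨ e + y₄ = x₄ + n)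
    (c1 : (h₁ = A ∧ h₁' = A') ∨ (h₁ = B ∧ h₁' = B'))
    (c2 : (h₂ = A ∧ h₂' = A') ∨ (h₂ = B ∧ h₂' = B'))
    (c3 : (h₃ = A ∧ h₃' = A') ∨ (h₃ = B ∧ h₃' = B'))
    (c4 : (h₄ = A ∧ h₄' = A') ∨ (h₄ = B ∧ h₄' = B')) :
    ¬ ((x₁ < h₁ ∧ ¬ y₁ < h₁') ∧ (y₂ < h₂' ∧ ¬ x₂ < h₂) ∧ (x₃ < h₃ ∧ ¬ y₃ < h₃') ∧
      (y₄ < h₄' ∧ ¬ x₄ < h₄)) ∧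
    ¬ ((y₁ < h₁' ∧ ¬ x₁ < h₁) ∧ (x₂ < h₂ ∧ ¬ y₂ < h₂') ∧ (y₃ < h₃' ∧ ¬ x₃ < h₃) ∧
      (x₄ < h₄ ∧ ¬ y₄ < h₄')) := by
  rcases c1 with ⟨rfl, rfl⟩ | ⟨rfl, rfl⟩ <;> rcases c2 with ⟨rfl, rfl⟩ | ⟨rfl, rfl⟩ <;>
  rcases c3 with ⟨rfl, rfl⟩ | ⟨rfl, rfl⟩ <;> rcases c4 with ⟨rfl, rfl⟩ | ⟨rfl, rfl⟩ <;>
  omega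

/-- The `k`-sets of the form `twoArc R S u (off u w + 1) B` with `u ∈ R` and `w ∈ S`. -/
def arcLayer (R S : Finset (ZMod n)) (k : ℕ) [NeZero n] : Finset (Finset (ZMod n)) :=
  univ.filter fun I => #I = k ∧
    ∃ u ∈ R, ∃ w ∈ S, ∃ B ≤ n, off u w < B ∧ I = twoArc R S u (off u w + 1) B

variable [NeZero n]

lemma not_crossing_twoArc (R S : Finset (ZMod n)) (u u' : ZMod n) {A B A' B' : ℕ} (hA : A ≤ B)
    (hA' : A' ≤ B') : ¬ Crossing (twoArc R S u A B) (twoArc R S u' A' B') := by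
  intro h
  obtain ⟨a, b, c, d, h1, h2, h3, h4⟩ := h.exists_base u
  have key : ∀ x : ZMod n, ((if x ∈ S then A else B) = A ∧ (if x ∈ S then A' else B') = A') ∨
      ((if x ∈ S then A else B) = B ∧ (if x ∈ S then A' else B') = B') := by
    intro x
    by_cases hx : x ∈ S <;> simp [hx]
  have := twoArc_alternation hA hA' h1 h2 h3 (off_lt u d) (off_lt u' b) (off_lt u' c) (off_lt u' d)
    (off_add_off u u' a) (off_add_off u u' b) (off_add_off u u' c)
    (off_add_off u u' d) (key a) (key b) (key c) (key d)
  simp only [mem_twoArc] at h4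
  tauto

lemma not_crossing_twoArc_of_subset {R S J : Finset (ZMod n)} (hJ : J ⊆ R \ S) (u : ZMod n)
    {A B : ℕ} (hAB : A ≤ B) : ¬ Crossing (twoArc R S u A B) J := by
  intro h
  obtain ⟨a, b, c, d, h1, h2, h3, h4⟩ := h.exists_base u
  have k1 : ∀ x ∈ twoArc R S u A B, off u x < B := fun x hx =>
    (mem_twoArc.1 hx).2.trans_le (by split_ifs <;> omega)
  have k2 : ∀ x ∈ J, x ∉ twoArc R S u A B → B ≤ off u x := by
    intro x hx hx'
    have hxR := mem_sdiff.1 (hJ hx)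
    by_contra hcon
    exact hx' (mem_twoArc.2 ⟨hxR.1, by rw [if_neg hxR.2]; omega⟩)
  rcases h4 with ⟨-, ⟨hb, hb'⟩, ⟨hc, -⟩, -⟩ | ⟨⟨ha, ha'⟩, ⟨hb, -⟩, -, -⟩
  · have := k1 c hc
    have := k2 b hb hb'
    omega
  · have := k1 b hb
    have := k2 a ha ha'
    omega

lemma card_twoArc_succ_le (R S : Finset (ZMod n)) (u : ZMod n) (A B : ℕ) :
    #(twoArc R S u A (B + 1)) ≤ #(twoArc R S u A B) + 1 := by
  refine (card_le_card (t := insert (u + (B : ZMod n)) (twoArc R S u A B)) fun x hx => ?_).trans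
    (card_insert_le _ _)
  rw [mem_twoArc] at hx
  rw [mem_insert, mem_twoArc]
  by_cases hxS : x ∈ S
  · simp only [hxS, if_true] at hx ⊢
    exact Or.inr hx
  · simp only [hxS, if_false] at hx ⊢
    rcases Nat.lt_or_ge (off u x) B with h | h
    · exact Or.inr ⟨hx.1, h⟩
    · left
      have : off u x = B := by omega
      rw [← this, off, ZMod.natCast_zmod_val]
      ring

lemma exists_card_twoArc_eq {R S : Finset (ZMod n)} {u w : ZMod n} {k : ℕ}
    (h : #{x ∈ R | off x w ≤ off u w} ≤ k) (hk : k ≤ #(R \ S)) :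
    ∃ B ≤ n, off u w < B ∧ #(twoArc R S u (off u w + 1) B) = k := by
  have h1 : #(twoArc R S u (off u w + 1) (off u w + 1)) ≤ k := by
    refine (card_le_card fun x hx => ?_).trans h
    rw [mem_twoArc, ite_self] at hx
    rw [mem_filter]
    have := off_add_off u x w
    have := off_lt x w
    exact ⟨hx.1, by omega⟩
  have h2 : k ≤ #(twoArc R S u (off u w + 1) n) := by
    refine hk.trans (card_le_card fun x hx => ?_)
    rw [mem_sdiff] at hx
    rw [mem_twoArc, if_neg hx.2]
    exact ⟨hx.1, off_lt u x⟩
  obtain ⟨B, hB, hBn, hBk⟩ :=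
    exists_eq_of_step (f := fun B => #(twoArc R S u (off u w + 1) B))
      (card_twoArc_succ_le R S u (off u w + 1)) (off_lt u w) h1 h2
  exact ⟨B, hBn, hB, hBk⟩

lemma mem_arcLayer {R S I : Finset (ZMod n)} {k : ℕ} : I ∈ arcLayer R S k ↔ #I = k ∧
    ∃ u ∈ R, ∃ w ∈ S, ∃ B ≤ n, off u w < B ∧ I = twoArc R S u (off u w + 1) B := by
  simp [arcLayer]

lemma twoArc_injective {R S : Finset (ZMod n)} {k : ℕ} (hSR : S ⊆ R) (hk : k ≤ #(R \ S))
    {u w u' w' : ZMod n} {B B' : ℕ} (hu : u ∈ R) (hw : w ∈ S) (hB : off u w < B)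
    (hu' : u' ∈ R) (hw' : w' ∈ S) (hB' : off u' w' < B')
    (hc : #(twoArc R S u (off u w + 1) B) = k)
    (h : twoArc R S u (off u w + 1) B = twoArc R S u' (off u' w' + 1) B') :
    u = u' ∧ w = w' := by
  have hwI : w ∈ twoArc R S u (off u w + 1) B := by
    rw [mem_twoArc, if_pos hw]
    exact ⟨hSR hw, by omega⟩
  have hwI' : w' ∈ twoArc R S u' (off u' w' + 1) B' := by
    rw [mem_twoArc, if_pos hw']
    exact ⟨hSR hw', by omega⟩
  have huI : u ∈ twoArc R S u (off u w + 1) B := by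
    rw [mem_twoArc, off_self]
    exact ⟨hu, by split_ifs <;> omega⟩
  have huI' : u' ∈ twoArc R S u' (off u' w' + 1) B' := by
    rw [mem_twoArc, off_self]
    exact ⟨hu', by split_ifs <;> omega⟩
  obtain ⟨z, hz, hzI⟩ : ∃ z ∈ R \ S, z ∉ twoArc R S u (off u w + 1) B := by
    by_contra! hcon
    have h1 : R \ S ⊂ twoArc R S u (off u w + 1) B :=
      (ssubset_iff_of_subset hcon).2 ⟨w, hwI, fun hw'' => (mem_sdiff.1 hw'').2 hw⟩
    have := card_lt_card h1
    omega
  have key : ∀ {v y : ZMod n} {C : ℕ}, off v y < C → z ∉ twoArc R S v (off v y + 1) C →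
      ∀ x ∈ twoArc R S v (off v y + 1) C, off z v ≤ off z x := by
    intro v y C hyC hzv x hx
    rw [mem_sdiff] at hz
    rw [mem_twoArc, if_neg hz.2] at hzv
    have h1 : C ≤ off v z := by
      by_contra hcon
      exact hzv ⟨hz.1, by omega⟩
    have h2 : off v x < C := (mem_twoArc.1 hx).2.trans_le (by split_ifs <;> omega)
    have := off_add_off v x z
    have := off_add_off z v x
    have := off_add_off_swap (a := v) (b := z) (by rintro rfl; rw [off_self] at h1; omega)
    have := off_lt z x
    have := off_lt z v
    omega
  have huu : u = u' := by
    apply off_injective z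
    have := key hB hzI u' (h ▸ huI')
    have := key hB' (h ▸ hzI) u (h ▸ huI)
    omega
  subst huu
  refine ⟨rfl, off_injective u ?_⟩
  rw [h, mem_twoArc, if_pos hw] at hwI
  rw [← h, mem_twoArc, if_pos hw'] at hwI'
  omega

lemma mul_card_le_card_arcLayer {R S : Finset (ZMod n)} {k : ℕ} (hSR : S ⊆ R)
    (hk : k ≤ #(R \ S)) : k * #S ≤ #(arcLayer R S k) := by
  let U : ZMod n → Finset (ZMod n) := fun w => {u ∈ R | #{x ∈ R | off x w ≤ off u w} ≤ k}
  have hU : ∀ w, k ≤ #(U w) := fun w =>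
    card_filter_card_le (fun x => off x w) k R (off_injective_left w).injOn
      (hk.trans (card_le_card sdiff_subset))
  have h1 : ∀ w u, u ∈ U w → ∃ B ≤ n, off u w < B ∧ #(twoArc R S u (off u w + 1) B) = k :=
    fun w u hu => exists_card_twoArc_eq (mem_filter.1 hu).2 hk
  choose! B hBn hB hBk using h1
  calc k * #S = ∑ w ∈ S, k := by rw [sum_const, smul_eq_mul, mul_comm]
    _ ≤ ∑ w ∈ S, #(U w) := sum_le_sum fun w _ => hU w
    _ = #(S.sigma U) := (card_sigma _ _).symm
    _ ≤ #(arcLayer R S k) := by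
      refine card_le_card_of_injOn (fun p => twoArc R S p.2 (off p.2 p.1 + 1) (B p.1 p.2)) ?_ ?_
      · rintro ⟨w, u⟩ hp
        obtain ⟨hw, hu⟩ := mem_sigma.1 hp
        exact mem_arcLayer.2 ⟨hBk w u hu, u, (mem_filter.1 hu).1, w, hw, B w u, hBn w u hu,
          hB w u hu, rfl⟩
      · rintro ⟨w, u⟩ hp ⟨w', u'⟩ hp' h
        obtain ⟨hw, hu⟩ := mem_sigma.1 hp
        obtain ⟨hw', hu'⟩ := mem_sigma.1 hp'
        obtain ⟨rfl, rfl⟩ := twoArc_injective hSR hk (mem_filter.1 hu).1 hw (hB w u hu)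
          (mem_filter.1 hu').1 hw' (hB w' u' hu') (hBk w u hu) h
        rfl

/-- There is a rotation-symmetric noncrossing family of `k`-subsets of `R` of full size. -/
def HasFullFam (g : ZMod n) (k : ℕ) (R : Finset (ZMod n)) : Prop :=
  ∃ D, CycFam n k D ∧ RotClosed g D ∧ (∀ I ∈ D, I ⊆ R) ∧ k * #R + 1 ≤ #D + k * k

lemma hasFullFam_base {g : ZMod n} {k : ℕ} {R : Finset (ZMod n)} (hR : rot g R = R)
    (hk : #R = k ∨ #R = k + 1) : HasFullFam g k R := by
  refine ⟨powersetCard k R, ⟨fun I hI => (mem_powersetCard.1 hI).2, fun I hI J hJ => ?_⟩,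
    fun I hI => ?_, fun I hI => (mem_powersetCard.1 hI).1, ?_⟩
  · rintro ⟨a, b, c, d, ha, hb, hc, hd, h1, h2⟩
    rw [mem_powersetCard] at hI hJ
    have hac : a = c := by
      refine (card_le_one (s := R \ J)).1 ?_ a (mem_sdiff.2 ⟨hI.1 ha.1, ha.2⟩) c
        (mem_sdiff.2 ⟨hI.1 hc.1, hc.2⟩)
      rw [card_sdiff_of_subset hJ.1]
      omega
    rw [hac, off_self] at h1
    omega
  · rw [mem_powersetCard] at hI ⊢
    refine ⟨?_, by rw [card_rot, hI.2]⟩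
    rw [← hR]
    exact map_subset_map.2 hI.1
  · rw [card_powersetCard]
    rcases hk with h | h
    · rw [h, Nat.choose_self]
      omega
    · rw [h, Nat.choose_succ_self_right]
      nlinarith

lemma HasFullFam.extend {g : ZMod n} {k : ℕ} {R S : Finset (ZMod n)} (hSR : S ⊆ R)
    (hR : rot g R = R) (hS : rot g S = S) (hk : k ≤ #(R \ S)) (h : HasFullFam g k (R \ S)) :
    HasFullFam g k R := by
  obtain ⟨D, hD, hDg, hDR, hDc⟩ := h
  have hdisj : Disjoint D (arcLayer R S k) := by
    rw [disjoint_left]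
    intro I hI hI'
    obtain ⟨-, u, -, w, hw, B, -, -, rfl⟩ := mem_arcLayer.1 hI'
    refine (mem_sdiff.1 (hDR _ hI (?_ : w ∈ _))).2 hw
    rw [mem_twoArc, if_pos hw]
    exact ⟨hSR hw, by omega⟩
  have hcross : ∀ I ∈ arcLayer R S k, ∀ J ∈ D, ¬ Crossing I J := by
    intro I hI J hJ
    obtain ⟨-, u, -, w, -, B, -, hB, rfl⟩ := mem_arcLayer.1 hI
    exact not_crossing_twoArc_of_subset (hDR J hJ) u hB
  refine ⟨D ∪ arcLayer R S k, ⟨fun I hI => ?_, fun I hI J hJ => ?_⟩, fun I hI => ?_,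
    fun I hI => ?_, ?_⟩
  · rcases mem_union.1 hI with hI | hI
    · exact hD.card_mem I hI
    · exact (mem_arcLayer.1 hI).1
  · rcases mem_union.1 hI with hI | hI <;> rcases mem_union.1 hJ with hJ | hJ
    · exact hD.noncross I hI J hJ
    · exact fun h => hcross J hJ I hI h.symm
    · exact hcross I hI J hJ
    · obtain ⟨-, u, -, w, -, B, -, hB, rfl⟩ := mem_arcLayer.1 hI
      obtain ⟨-, u', -, w', -, B', -, hB', rfl⟩ := mem_arcLayer.1 hJ
      exact not_crossing_twoArc R S u u' hB hB'
  · rcases mem_union.1 hI with hI | hI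
    · exact mem_union_left _ (hDg I hI)
    · obtain ⟨hc, u, hu, w, hw, B, hBn, hB, rfl⟩ := mem_arcLayer.1 hI
      refine mem_union_right _ (mem_arcLayer.2 ⟨by rw [card_rot, hc], u + g,
        (mem_add_of_rot_eq hR).2 hu, w + g, (mem_add_of_rot_eq hS).2 hw, B, hBn, ?_, ?_⟩)
      · rwa [off_add_add]
      · rw [rot_twoArc hR hS, off_add_add]
  · rcases mem_union.1 hI with hI | hI
    · exact (hDR I hI).trans sdiff_subset
    · obtain ⟨-, u, -, w, -, B, -, -, rfl⟩ := mem_arcLayer.1 hI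
      exact filter_subset _ _
  · rw [card_union_of_disjoint hdisj]
    have h1 := mul_card_le_card_arcLayer hSR hk
    have h2 := card_sdiff_add_card_eq_card hSR
    rw [← h2, mul_add]
    omega

lemma exists_rot_invariant_subset {g x : ZMod n} {R : Finset (ZMod n)} (hR : rot g R = R)
    (hx : x ∈ R) : ∃ S ⊆ R, rot g S = S ∧ #S = addOrderOf g := by
  have hd := addOrderOf_pos g
  have hsub : rot g ((range (addOrderOf g)).image fun j => x + j • g) ⊆
      (range (addOrderOf g)).image fun j => x + j • g := by
    intro y hy
    rw [mem_rot] at hy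
    obtain ⟨j, -, hj⟩ := mem_image.1 hy
    refine mem_image.2 ⟨(j + 1) % addOrderOf g, mem_range.2 (Nat.mod_lt _ hd), ?_⟩
    rw [mod_addOrderOf_nsmul, succ_nsmul, ← add_assoc, hj, sub_add_cancel]
  refine ⟨(range (addOrderOf g)).image fun j => x + j • g, ?_,
    eq_of_subset_of_card_le hsub (card_rot _ _).ge, ?_⟩
  · intro y hy
    obtain ⟨j, -, rfl⟩ := mem_image.1 hy
    exact (mem_add_of_rot_eq (rot_eq_self_nsmul hR j)).2 hx
  · rw [card_image_of_injOn, card_range]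
    intro i hi j hj hij
    exact nsmul_injOn_Iio_addOrderOf (by simpa using hi) (by simpa using hj)
      (add_left_cancel hij)

lemma hasFullFam_of_dvd {g : ZMod n} {k : ℕ} (hk : addOrderOf g ∣ k ∨ addOrderOf g ∣ k + 1)
    (N : ℕ) : ∀ R : Finset (ZMod n), #R = N → rot g R = R → k ≤ #R → HasFullFam g k R := by
  induction N using Nat.strong_induction_on with
  | _ N ih =>
    intro R hN hR hkR
    by_cases hbase : #R = k ∨ #R = k + 1
    · exact hasFullFam_base hR hbase
    push Not at hbase
    obtain ⟨x, hx⟩ : R.Nonempty := card_pos.1 (by omega)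
    obtain ⟨S, hSR, hS, hSc⟩ := exists_rot_invariant_subset hR hx
    have hc := card_sdiff_add_card_eq_card hSR
    have hdR := dvd_of_rot_eq hR
    have hd := addOrderOf_pos g
    have hle : k ≤ #(R \ S) := by
      rcases hk with h | h
      · have := Nat.le_of_dvd (by omega) (Nat.dvd_sub hdR h)
        omega
      · have := Nat.le_of_dvd (by omega) (Nat.dvd_sub hdR h)
        omega
    have hRS : rot g (R \ S) = R \ S := by
      conv_rhs => rw [← hR, ← hS]
      ext y
      simp only [mem_rot, mem_sdiff]
    exact (ih _ (by omega) _ rfl hRS hle).extend hSR hR hS hle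

lemma rot_univ (g : ZMod n) : rot g univ = univ := by
  ext x
  simp [mem_rot]

lemma exists_cycFam_of_dvd {g : ZMod n} {k m : ℕ} (hn : k + m = n)
    (hk : addOrderOf g ∣ k ∨ addOrderOf g ∣ k + 1) :
    ∃ D, CycFam n k D ∧ RotClosed g D ∧ #D = k * m + 1 := by
  obtain ⟨D, hD, hg, -, hc⟩ := hasFullFam_of_dvd hk n univ (by simp [ZMod.card]) (rot_univ g)
    (by rw [card_univ, ZMod.card]; omega)
  refine ⟨D, hD, hg, le_antisymm (hD.card_le hn) ?_⟩
  rw [card_univ, ZMod.card] at hc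
  subst hn
  nlinarith

lemma Crossing.of_compl {I J : Finset (ZMod n)} (h : Crossing Iᶜ Jᶜ) : Crossing J I := by
  obtain ⟨a, b, c, d, ha, hb, hc, hd, h1⟩ := h
  simp only [mem_compl, not_not] at ha hb hc hd
  exact ⟨a, b, c, d, ha.symm, hb.symm, hc.symm, hd.symm, h1⟩

theorem exists_cycFam {g : ZMod n} {k m : ℕ} (hn : k + m = n) (hk1 : 1 ≤ k)
    (hk : addOrderOf g ∣ k ∨ addOrderOf g ∣ k - 1 ∨ addOrderOf g ∣ k + 1) :
    ∃ D, CycFam n k D ∧ RotClosed g D ∧ #D = k * m + 1 := by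
  by_cases hk' : addOrderOf g ∣ k ∨ addOrderOf g ∣ k + 1
  · exact exists_cycFam_of_dvd hn hk'
  have hd : addOrderOf g ∣ k - 1 := by tauto
  have hdn : addOrderOf g ∣ n := by
    have := addOrderOf_dvd_card (x := g)
    rwa [ZMod.card] at this
  have hm : addOrderOf g ∣ m + 1 := by
    have := Nat.dvd_sub hdn hd
    rwa [show n - (k - 1) = m + 1 by omega] at this
  obtain ⟨D, hD, hDg, hc⟩ := exists_cycFam_of_dvd (g := g) (k := m) (m := k) (by omega) (Or.inr hm)
  refine ⟨D.image compl, ⟨?_, ?_⟩, ?_, ?_⟩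
  · simp only [forall_mem_image, card_compl, ZMod.card]
    intro I hI
    rw [hD.card_mem I hI]
    omega
  · simp only [forall_mem_image]
    exact fun I hI J hJ h => hD.noncross J hJ I hI h.of_compl
  · simp only [RotClosed, forall_mem_image]
    intro I hI
    refine mem_image.2 ⟨rot g I, hDg I hI, ?_⟩
    ext x
    simp [mem_rot]
  · rw [card_image_of_injective _ compl_injective, hc, mul_comm]

end Sufficiency

section Bridge

variable {n : ℕ}

lemma exists_natCast_eq [NeZero n] (y : ZMod n) : ∃ x ∈ Icc 1 n, (x : ZMod n) = y := by
  refine ⟨off 1 y + 1, mem_Icc.2 ⟨by omega, off_lt 1 y⟩, ?_⟩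
  rw [off]
  push_cast
  rw [ZMod.natCast_zmod_val]
  ring

lemma off_one_natCast {x : ℕ} (hx : x ∈ Icc 1 n) : off (1 : ZMod n) (x : ZMod n) + 1 = x := by
  rw [mem_Icc] at hx
  obtain ⟨y, rfl⟩ : ∃ y, x = y + 1 := ⟨x - 1, by omega⟩
  have := off_add_natCast (n := n) (i := y) (by omega) 1
  push_cast
  rw [add_comm (y : ZMod n), this]

/-- The residues modulo `n` of a set of integers. -/
def residues (n : ℕ) (I : Finset ℕ) : Finset (ZMod n) := I.image (Nat.cast : ℕ → ZMod n)

lemma natCast_mem_residues {I : Finset ℕ} (hI : I ⊆ Icc 1 n) {x : ℕ} (hx : x ∈ Icc 1 n) :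
    (x : ZMod n) ∈ residues n I ↔ x ∈ I := by
  refine ⟨fun h => ?_, fun h => mem_image_of_mem _ h⟩
  obtain ⟨y, hy, hyx⟩ := mem_image.1 h
  rwa [← off_one_natCast hx, ← hyx, off_one_natCast (hI hy)]

lemma card_residues {I : Finset ℕ} (hI : I ⊆ Icc 1 n) : #(residues n I) = #I := by
  refine card_image_of_injOn fun x hx y hy h => ?_
  rw [← off_one_natCast (hI hx), ← off_one_natCast (hI hy)]
  exact congrArg (fun z => off 1 z + 1) h

lemma residues_injOn : Set.InjOn (residues n) {I | I ⊆ Icc 1 n} := by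
  intro I hI J hJ h
  ext x
  by_cases hx : x ∈ Icc 1 n
  · rw [← natCast_mem_residues hI hx, h, natCast_mem_residues hJ hx]
  · exact ⟨fun h => (hx (hI h)).elim, fun h => (hx (hJ h)).elim⟩

lemma exists_residues_eq [NeZero n] (J : Finset (ZMod n)) : ∃ I ⊆ Icc 1 n, residues n I = J := by
  refine ⟨{x ∈ Icc 1 n | (x : ZMod n) ∈ J}, filter_subset _ _, ?_⟩
  ext y
  obtain ⟨x, hx, rfl⟩ := exists_natCast_eq y
  rw [natCast_mem_residues (filter_subset _ _) hx, mem_filter, and_iff_right hx]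

lemma weaklySeparated_iff [NeZero n] {I J : Finset ℕ} (hI : I ⊆ Icc 1 n) (hJ : J ⊆ Icc 1 n) :
    WeaklySeparated I J ↔ ¬ Crossing (residues n I) (residues n J) := by
  rw [WeaklySeparated, not_iff_not]
  have hmem : ∀ {x}, x ∈ Icc 1 n → ∀ {K : Finset ℕ}, K ⊆ Icc 1 n →
      ((x : ZMod n) ∈ residues n K ↔ x ∈ K) := fun hx _ hK => natCast_mem_residues hK hx
  constructor
  · rintro ⟨a, b, c, d, hab, hbc, hcd, h⟩
    have hIJ : ∀ x, x ∈ I \ J ∨ x ∈ J \ I → x ∈ Icc 1 n := by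
      rintro x (hx | hx)
      · exact hI (mem_sdiff.1 hx).1
      · exact hJ (mem_sdiff.1 hx).1
    have ha := hIJ a (by tauto)
    have hb := hIJ b (by tauto)
    have hc := hIJ c (by tauto)
    have hd := hIJ d (by tauto)
    have ea := off_one_natCast ha
    have eb := off_one_natCast hb
    have ec := off_one_natCast hc
    have ed := off_one_natCast hd
    simp only [mem_sdiff, ← hmem ha hI, ← hmem ha hJ, ← hmem hb hI, ← hmem hb hJ, ← hmem hc hI,
      ← hmem hc hJ, ← hmem hd hI, ← hmem hd hJ] at h
    rcases h with ⟨h1, h2, h3, h4⟩ | ⟨h1, h2, h3, h4⟩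
    · exact crossing_of_base 1 h1 h3 h2 h4 (by omega) (by omega) (by omega)
    · exact (crossing_of_base 1 h1 h3 h2 h4 (by omega) (by omega) (by omega)).symm
  · intro h
    obtain ⟨a, b, c, d, h1, h2, h3, h⟩ := h.exists_base 1
    obtain ⟨a, ha, rfl⟩ := exists_natCast_eq a
    obtain ⟨b, hb, rfl⟩ := exists_natCast_eq b
    obtain ⟨c, hc, rfl⟩ := exists_natCast_eq c
    obtain ⟨d, hd, rfl⟩ := exists_natCast_eq d
    have ea := off_one_natCast ha
    have eb := off_one_natCast hb
    have ec := off_one_natCast hc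
    have ed := off_one_natCast hd
    simp only [hmem ha hI, hmem ha hJ, hmem hb hI, hmem hb hJ, hmem hc hI, hmem hc hJ, hmem hd hI,
      hmem hd hJ] at h
    refine ⟨a, b, c, d, by omega, by omega, by omega, ?_⟩
    simp only [mem_sdiff]
    tauto

lemma shiftSet_subset [NeZero n] (t : ℕ) (I : Finset ℕ) : shiftSet n t I ⊆ Icc 1 n := by
  intro y hy
  obtain ⟨x, -, rfl⟩ := mem_image.1 hy
  have := Nat.mod_lt (x + t - 1) (NeZero.pos n)
  rw [mem_Icc, shiftMod]
  omega

lemma residues_shiftSet {t : ℕ} {I : Finset ℕ} (hI : I ⊆ Icc 1 n) :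
    residues n (shiftSet n t I) = rot (t : ZMod n) (residues n I) := by
  rw [residues, shiftSet, image_image, rot, residues, map_eq_image, image_image]
  refine image_congr fun x hx => ?_
  obtain ⟨y, rfl⟩ : ∃ y, x = y + 1 := ⟨x - 1, by have := mem_Icc.1 (hI hx); omega⟩
  simp only [Function.comp_apply, shiftMod, Equiv.coe_toEmbedding, Equiv.coe_addRight]
  rw [show y + 1 + t - 1 = y + t by omega]
  push_cast
  rw [ZMod.natCast_mod]
  push_cast
  ring

lemma exists_symmetric_iff [NeZero n] (k ℓ N : ℕ) :
    (∃ D : Finset (Finset ℕ), (∀ I ∈ D, I ⊆ Icc 1 n ∧ #I = k) ∧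
        (∀ I ∈ D, ∀ J ∈ D, WeaklySeparated I J) ∧ (∀ I ∈ D, shiftSet n ℓ I ∈ D) ∧ #D = N) ↔
      ∃ D, CycFam n k D ∧ RotClosed (ℓ : ZMod n) D ∧ #D = N := by
  constructor
  · rintro ⟨D, h1, h2, h3, h4⟩
    refine ⟨D.image (residues n), ⟨?_, ?_⟩, ?_, ?_⟩
    · simp only [forall_mem_image]
      exact fun I hI => (card_residues (h1 I hI).1).trans (h1 I hI).2
    · simp only [forall_mem_image]
      exact fun I hI J hJ => (weaklySeparated_iff (h1 I hI).1 (h1 J hJ).1).1 (h2 I hI J hJ)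
    · simp only [RotClosed, forall_mem_image]
      intro I hI
      rw [← residues_shiftSet (h1 I hI).1]
      exact mem_image_of_mem _ (h3 I hI)
    · rw [card_image_of_injOn (residues_injOn.mono fun I hI => (h1 I hI).1), h4]
  · rintro ⟨D, hD, hg, hc⟩
    have hmem : ∀ I, I ∈ {I ∈ (Icc 1 n).powerset | residues n I ∈ D} ↔
        I ⊆ Icc 1 n ∧ residues n I ∈ D := fun I => by rw [mem_filter, mem_powerset]
    refine ⟨{I ∈ (Icc 1 n).powerset | residues n I ∈ D}, ?_, ?_, ?_, ?_⟩
    · intro I hI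
      obtain ⟨hI, hID⟩ := (hmem I).1 hI
      exact ⟨hI, card_residues hI ▸ hD.card_mem _ hID⟩
    · intro I hI J hJ
      obtain ⟨hI, hID⟩ := (hmem I).1 hI
      obtain ⟨hJ, hJD⟩ := (hmem J).1 hJ
      exact (weaklySeparated_iff hI hJ).2 (hD.noncross _ hID _ hJD)
    · intro I hI
      obtain ⟨hI, hID⟩ := (hmem I).1 hI
      exact (hmem _).2 ⟨shiftSet_subset ℓ I, residues_shiftSet hI ▸ hg _ hID⟩
    · rw [← hc, ← card_image_of_injOn
        (residues_injOn.mono fun I hI => ((hmem I).1 hI).1)]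
      congr 1
      ext J
      rw [mem_image]
      constructor
      · rintro ⟨I, hI, rfl⟩
        exact ((hmem I).1 hI).2
      · intro hJ
        obtain ⟨I, hI, rfl⟩ := exists_residues_eq J
        exact ⟨I, (hmem I).2 ⟨hI, hJ⟩, rfl⟩

end Bridge

/-- For `n ≥ 2`, `1 ≤ k ≤ n−1`, `ℓ ≥ 1` and `d = n / gcd(n, ℓ)`, there
exists a `ρ^ℓ`-symmetric weakly separated collection `D ⊆ C([n], k)` of cardinality
`k(n−k)+1` if and only if `k ≡ −1, 0, 1 (mod d)`. -/
theorem stmt0 (n k ℓ : ℕ) (hn : 2 ≤ n) (hk1 : 1 ≤ k) (hk2 : k ≤ n - 1) (hl : 1 ≤ ℓ)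
    (d : ℕ) (hd : d = n / Nat.gcd n ℓ) :
    (∃ D : Finset (Finset ℕ),
        (∀ I ∈ D, I ⊆ Finset.Icc 1 n ∧ I.card = k) ∧
        (∀ I ∈ D, ∀ J ∈ D, WeaklySeparated I J) ∧
        (∀ I ∈ D, shiftSet n ℓ I ∈ D) ∧
        D.card = k * (n - k) + 1) ↔
      (∃ c : ℤ, (c = -1 ∨ c = 0 ∨ c = 1) ∧ (d : ℤ) ∣ ((k : ℤ) - c)) := by
  have : NeZero n := ⟨by omega⟩
  have hord : addOrderOf (ℓ : ZMod n) = d := by rw [ZMod.addOrderOf_coe ℓ (by omega), hd]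
  have hnk : k + (n - k) = n := by omega
  rw [exists_symmetric_iff]
  trans d ∣ k ∨ d ∣ k - 1 ∨ d ∣ k + 1
  · rw [← hord]
    exact ⟨fun ⟨D, hD, hg, hc⟩ => hD.addOrderOf_dvd_of_rotClosed hg hnk hk1 (by omega) hc,
      exists_cycFam hnk hk1⟩
  · simp only [or_and_right, exists_or, exists_eq_left, sub_zero, sub_neg_eq_add]
    rw [← Int.natCast_dvd_natCast, ← Int.natCast_dvd_natCast (n := k - 1),
      ← Int.natCast_dvd_natCast (n := k + 1), Nat.cast_sub hk1]
    push_cast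
    tauto
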